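/- arXiv:1708.02692 — 2 statements merged into one kernel-verified Lean document; each statement's English description precedes it below -/
import Mathlib

section
/- For integers n ≥ 5 and 2 ≤ k ≤ n−1, the R_2-vertex-connectivity of the Cayley graph T_kG_n generated by a k-tree on n vertices satisfies κ^2(T_kG_n) = 4(kn − k(k+1)/2) − 10. -/
/-- The transposition generating graph `G(𝒯)` of a set `T` of transpositions of `Sym(n)`:
vertices `{1,…,n}` (modeled as `Fin n`), with an edge `i j` iff the transposition
`(i j)` belongs to `T`. -/
def transGraph {n : ℕ} (T : Set (Equiv.Perm (Fin n))) : SimpleGraph (Fin n) :=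
  SimpleGraph.fromRel (fun i j => Equiv.swap i j ∈ T)

/-- The Cayley graph `Cay(Sym(n), T)`: vertices are permutations, and `g, h` are
adjacent iff `h = g * t` for some `t ∈ T`. -/
def cayley {n : ℕ} (T : Set (Equiv.Perm (Fin n))) : SimpleGraph (Equiv.Perm (Fin n)) :=
  SimpleGraph.fromRel (fun g h => ∃ t ∈ T, h = g * t)

/-- `G` is a `k`-tree: there is a construction ordering of the vertices in which the
first `k+1` vertices are mutually adjacent, and each later vertex is joined to exactly
`k` mutually adjacent earlier vertices. -/
def IsKTree (k : ℕ) {V : Type*} [Fintype V] (G : SimpleGraph V) : Prop :=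
  k + 1 ≤ Fintype.card V ∧
  ∃ e : Fin (Fintype.card V) ≃ V,
    (∀ i j : Fin (Fintype.card V), j < i → (i : ℕ) ≤ k → G.Adj (e i) (e j)) ∧
    ∀ i : Fin (Fintype.card V), k + 1 ≤ (i : ℕ) →
      {j : Fin (Fintype.card V) | j < i ∧ G.Adj (e i) (e j)}.ncard = k ∧
      {j : Fin (Fintype.card V) | j < i ∧ G.Adj (e i) (e j)}.Pairwise
        (fun j₁ j₂ => G.Adj (e j₁) (e j₂))

/-- `F` is an `R_k`-vertex-cut of `G`: `G - F` is disconnected and every vertex of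
`G - F` has at least `k` neighbors in `G - F`. -/
def IsRkCut {V : Type*} (G : SimpleGraph V) (k : ℕ) (F : Set V) : Prop :=
  ¬ (G.induce (Fᶜ : Set V)).Connected ∧
  ∀ v : V, v ∉ F → k ≤ {u : V | u ∉ F ∧ G.Adj v u}.ncard

/-- The `R_k`-vertex-connectivity `κ^k(G)`: the minimum cardinality of an
`R_k`-vertex-cut of `G`. -/
noncomputable def rkConn {V : Type*} (G : SimpleGraph V) (k : ℕ) : ℕ :=
  sInf {m : ℕ | ∃ F : Set V, IsRkCut G k F ∧ F.ncard = m}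

namespace KT
open Equiv Finset

theorem sum_ge2 {ι : Type*} [Fintype ι] [DecidableEq ι] (z : ι → ℕ) {i j : ι} (h : i ≠ j) :
    z i + z j ≤ ∑ k, z k := by
  rw [← Finset.sum_pair h]
  exact Finset.sum_le_sum_of_subset (Finset.subset_univ _)

theorem sum_ge3 {ι : Type*} [Fintype ι] [DecidableEq ι] (z : ι → ℕ) {i j l : ι} (h : i ≠ j)
    (h1 : i ≠ l) (h2 : j ≠ l) : z i + z j + z l ≤ ∑ k, z k := by
  have : ∑ k ∈ ({i, j, l} : Finset ι), z k = z i + z j + z l := by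
    rw [Finset.sum_insert (by simp [h, h1]), Finset.sum_pair h2]; ring
  rw [← this]
  exact Finset.sum_le_sum_of_subset (Finset.subset_univ _)

theorem sum_ge4 {ι : Type*} [Fintype ι] [DecidableEq ι] (z : ι → ℕ) {i j l o : ι} (h : i ≠ j)
    (h1 : i ≠ l) (h2 : j ≠ l) (h3 : i ≠ o) (h4 : j ≠ o) (h5 : l ≠ o) :
    z i + z j + z l + z o ≤ ∑ k, z k := by
  have : ∑ k ∈ ({i, j, l, o} : Finset ι), z k = z i + z j + z l + z o := by
    rw [Finset.sum_insert (by simp [h, h1, h3]), Finset.sum_insert (by simp [h2, h4]),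
      Finset.sum_pair h5]; ring
  rw [← this]
  exact Finset.sum_le_sum_of_subset (Finset.subset_univ _)

theorem sum_split1 {ι : Type*} [Fintype ι] [DecidableEq ι] (z : ι → ℕ) (i : ι) :
    z i + ∑ k ∈ univ.filter (fun k => k ≠ i), z k = ∑ k, z k := by
  have : univ.filter (fun k => k ≠ i) = univ.erase i := by ext; simp
  rw [this, Finset.add_sum_erase _ _ (Finset.mem_univ i)]

theorem sum_split2 {ι : Type*} [Fintype ι] [DecidableEq ι] (z : ι → ℕ) {i j : ι} (h : i ≠ j) :
    z i + z j + ∑ k ∈ univ.filter (fun k => k ≠ i ∧ k ≠ j), z k = ∑ k, z k := by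
  have : univ.filter (fun k => k ≠ i ∧ k ≠ j) = (univ.erase i).erase j := by
    ext; simp [and_comm]
  rw [this, add_assoc, Finset.add_sum_erase _ _ (by simp [h.symm]),
    Finset.add_sum_erase _ _ (Finset.mem_univ i)]

/-- all copies unmixed, Y in one copy -/
theorem num_one {ι : Type*} [Fintype ι] [DecidableEq ι] (x y z : ι → ℕ) (N d : ℕ)
    (hz : ∀ i, x i + y i + z i = N)
    (hd1 : ∀ i, y i * d ≤ ∑ k ∈ univ.filter (fun k => k ≠ i), (y k + z k))
    (hY : 2 ≤ ∑ i, y i) (hdd : 2 ≤ d)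
    (q : ι) (hq : ∀ k, k ≠ q → y k = 0) (hxq : x q = 0) :
    N + 2 * d ≤ ∑ i, z i + 2 := by
  have h1 := sum_split1 z q
  have h2 := sum_split1 y q
  have h3 : ∑ k ∈ univ.filter (fun k => k ≠ q), y k = 0 :=
    Finset.sum_eq_zero (fun k hk => hq k (by simpa using hk))
  have h4 := hd1 q
  rw [Finset.sum_add_distrib, h3] at h4
  have h5 := hz q
  obtain ⟨d', rfl⟩ := Nat.exists_eq_add_of_le hdd
  have h6 : 2 ≤ y q := by omega
  nlinarith

/-- no mixed copies -/
theorem num_nomix {ι : Type*} [Fintype ι] [DecidableEq ι] (x y z : ι → ℕ) (N d e τ : ℕ)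
    (hz : ∀ i, x i + y i + z i = N)
    (hm : ∀ i, x i = 0 ∨ y i = 0)
    (hc : ∀ i j, i ≠ j → x i + y j + e ≤ 2 * N)
    (hd1 : ∀ i, y i * d ≤ ∑ k ∈ univ.filter (fun k => k ≠ i), (y k + z k))
    (hd1' : ∀ i, x i * d ≤ ∑ k ∈ univ.filter (fun k => k ≠ i), (x k + z k))
    (hX : 2 ≤ ∑ i, x i) (hY : 2 ≤ ∑ i, y i) (hdd : 2 ≤ d)
    (he : τ ≤ 2 * e) (hN : τ + 2 ≤ N + 2 * d) : τ ≤ ∑ i, z i := by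
  have key : ∀ (x y : ι → ℕ), (∀ i, x i + y i + z i = N) → (∀ i, x i = 0 ∨ y i = 0) →
      (∀ i, y i * d ≤ ∑ k ∈ univ.filter (fun k => k ≠ i), (y k + z k)) → 2 ≤ ∑ i, y i →
      τ ≤ ∑ i, z i ∨ ∃ q1 q2, q1 ≠ q2 ∧ x q1 = 0 ∧ x q2 = 0 ∧ 1 ≤ y q1 ∧ 1 ≤ y q2 := by
    intro x y hz hm hd1 hY
    obtain ⟨q, hq⟩ : ∃ q, 1 ≤ y q := by
      by_contra! h
      have : ∑ i, y i = 0 := Finset.sum_eq_zero (fun k _ => by have := h k; omega)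
      omega
    by_cases h : ∃ q2, q2 ≠ q ∧ 1 ≤ y q2
    · obtain ⟨q2, h1, h2⟩ := h
      right
      refine ⟨q, q2, h1.symm, ?_, ?_, hq, h2⟩
      · have := hm q; omega
      · have := hm q2; omega
    · push Not at h
      left
      have := num_one x y z N d hz hd1 hY hdd q (fun k hk => by have := h k hk; omega)
        (by have := hm q; omega)
      omega
  rcases key x y hz hm hd1 hY with h | ⟨q1, q2, hq, hx1, hx2, hy1, hy2⟩
  · exact h
  rcases key y x (fun i => by have := hz i; omega) (fun i => (hm i).symm) hd1' hX with
    h | ⟨p1, p2, hp, hu1, hu2, hv1, hv2⟩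
  · exact h
  have a1 : p1 ≠ q1 := by rintro rfl; omega
  have a2 : p1 ≠ q2 := by rintro rfl; omega
  have a3 : p2 ≠ q1 := by rintro rfl; omega
  have a4 : p2 ≠ q2 := by rintro rfl; omega
  have := sum_ge4 z hp a1 a3 a2 a4 hq
  have := hc p1 q1 a1
  have := hc p2 q2 a4
  have := hz p1; have := hz p2; have := hz q1; have := hz q2
  omega

theorem num_core {ι : Type*} [Fintype ι] [DecidableEq ι] (x y z : ι → ℕ) (N m d e : ℕ)
    (hz : ∀ i, x i + y i + z i = N)
    (hm : ∀ i, 1 ≤ x i → 1 ≤ y i → m ≤ z i + 1)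
    (hb : ∀ i, 2 ≤ x i → 2 ≤ y i → 2 * m ≤ z i + 6)
    (hc : ∀ i j, i ≠ j → x i + y j + e ≤ 2 * N)
    (hd : ∀ i j, y i * (d - 1) ≤ ∑ k ∈ univ.filter (fun k => k ≠ i ∧ k ≠ j), (y k + z k))
    (hd1 : ∀ i, y i * d ≤ ∑ k ∈ univ.filter (fun k => k ≠ i), (y k + z k))
    (hd' : ∀ i j, x i * (d - 1) ≤ ∑ k ∈ univ.filter (fun k => k ≠ i ∧ k ≠ j), (x k + z k))
    (hd1' : ∀ i, x i * d ≤ ∑ k ∈ univ.filter (fun k => k ≠ i), (x k + z k))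
    (hX : 3 ≤ ∑ i, x i) (hY : 3 ≤ ∑ i, y i) (hcard : 5 ≤ Fintype.card ι)
    (hdd : 2 ≤ d) (hm5 : 5 ≤ m) (c1 : 2 * d ≤ m + 2) (c4 : m + 2 * d ≤ e + 4)
    (c3 : 2 * m ≤ N + 2) : 2 * m + 2 * d ≤ ∑ i, z i + 5 := by
  -- three mixed
  by_cases hmix3 : ∃ i j l, i ≠ j ∧ i ≠ l ∧ j ≠ l ∧ (1 ≤ x i ∧ 1 ≤ y i) ∧ (1 ≤ x j ∧ 1 ≤ y j) ∧
      (1 ≤ x l ∧ 1 ≤ y l)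
  · obtain ⟨i, j, l, h1, h2, h3, a, b, c⟩ := hmix3
    have := sum_ge3 z h1 h2 h3
    have := hm i a.1 a.2
    have := hm j b.1 b.2
    have := hm l c.1 c.2
    omega
  by_cases hPQ : ∃ i j, i ≠ j ∧ y i = 0 ∧ x j = 0
  · obtain ⟨i, j, hij, hyi, hxj⟩ := hPQ
    by_cases hmx : ∃ l, 1 ≤ x l ∧ 1 ≤ y l
    · obtain ⟨l, hl1, hl2⟩ := hmx
      have a1 : i ≠ l := by rintro rfl; omega
      have a2 : j ≠ l := by rintro rfl; omega
      have := sum_ge3 z hij a1 a2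
      have := hm l hl1 hl2
      have := hc i j hij
      have := hz i; have := hz j
      omega
    · push Not at hmx
      have := num_nomix x y z N d e (2 * m + 2 * d - 5) hz
        (fun i => by have := hmx i; omega) hc hd1 hd1' (by omega) (by omega) hdd
        (by omega) (by omega)
      omega
  -- final case
  have key : ∀ (x y : ι → ℕ), (∀ i, x i + y i + z i = N) →
      (∀ i, 1 ≤ x i → 1 ≤ y i → m ≤ z i + 1) →
      (∀ i, 2 ≤ x i → 2 ≤ y i → 2 * m ≤ z i + 6) →
      (∀ i j, y i * (d - 1) ≤ ∑ k ∈ univ.filter (fun k => k ≠ i ∧ k ≠ j), (y k + z k)) →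
      (∀ i, y i * d ≤ ∑ k ∈ univ.filter (fun k => k ≠ i), (y k + z k)) →
      3 ≤ ∑ i, y i →
      (¬ ∃ i j l, i ≠ j ∧ i ≠ l ∧ j ≠ l ∧ (1 ≤ x i ∧ 1 ≤ y i) ∧ (1 ≤ x j ∧ 1 ≤ y j) ∧
      (1 ≤ x l ∧ 1 ≤ y l)) → (∀ i, 1 ≤ x i) → 2 * m + 2 * d ≤ ∑ i, z i + 5 := by
    intro x y hz hm hb hd hd1 hY hmix3 hx
    obtain ⟨i, hi, hmax⟩ : ∃ i, 1 ≤ y i ∧ ∀ j, y j ≤ y i := by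
      obtain ⟨i, -, hi⟩ := Finset.exists_max_image (univ : Finset ι) y
        (Finset.univ_nonempty_iff.2 (Fintype.card_pos_iff.1 (by omega)))
      refine ⟨i, ?_, fun j => hi j (mem_univ j)⟩
      by_contra h
      have : ∑ i, y i = 0 := Finset.sum_eq_zero
        (fun k _ => by have := hi k (mem_univ k); omega)
      omega
    obtain ⟨d', rfl⟩ := Nat.exists_eq_add_of_le hdd
    by_cases h2 : ∃ j, j ≠ i ∧ 1 ≤ y j
    · obtain ⟨j, hji, hj⟩ := h2
      have h0 : ∀ k, k ≠ i → k ≠ j → y k = 0 := by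
        intro k hki hkj
        by_contra h
        exact hmix3 ⟨i, j, k, hji.symm, hki.symm, hkj.symm, ⟨hx i, hi⟩, ⟨hx j, hj⟩,
          ⟨hx k, by omega⟩⟩
      have s1 := sum_split2 z hji.symm
      have s2 := sum_split2 y hji.symm
      have s3 : ∑ k ∈ univ.filter (fun k => k ≠ i ∧ k ≠ j), y k = 0 :=
        Finset.sum_eq_zero (fun k hk => by
          simp only [mem_filter, mem_univ, true_and] at hk; exact h0 k hk.1 hk.2)
      have s4 := hd i j
      rw [Finset.sum_add_distrib, s3] at s4
      have hyi : 2 ≤ y i := by have := hmax j; omega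
      have := hm j (hx j) hj
      have := hz i
      have e1 : 2 + d' - 1 = d' + 1 := by omega
      rw [e1] at s4
      by_cases hx2 : 2 ≤ x i
      · have := hb i hx2 hyi
        nlinarith
      · have hx1 : x i = 1 := by have := hx i; omega
        nlinarith
    · push Not at h2
      have s1 := sum_split1 z i
      have s2 := sum_split1 y i
      have s3 : ∑ k ∈ univ.filter (fun k => k ≠ i), y k = 0 :=
        Finset.sum_eq_zero (fun k hk => by
          simp only [mem_filter, mem_univ, true_and] at hk; have := h2 k hk; omega)
      have s4 := hd1 i
      rw [Finset.sum_add_distrib, s3] at s4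
      have hyi : 3 ≤ y i := by omega
      have := hz i
      by_cases hx2 : 2 ≤ x i
      · have := hb i hx2 (by omega)
        nlinarith
      · have hx1 : x i = 1 := by have := hx i; omega
        nlinarith
  -- two unmixed copies
  obtain ⟨u, v, huv, hu, hv⟩ : ∃ u v, u ≠ v ∧ (x u = 0 ∨ y u = 0) ∧ (x v = 0 ∨ y v = 0) := by
    set M := univ.filter (fun i => 1 ≤ x i ∧ 1 ≤ y i) with hM
    have hM2 : M.card ≤ 2 := by
      by_contra h
      obtain ⟨a, b, c, ha, hb, hc, h1, h2, h3⟩ := Finset.two_lt_card_iff.1 (not_le.1 h)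
      simp only [hM, mem_filter, mem_univ, true_and] at ha hb hc
      exact hmix3 ⟨a, b, c, h1, h2, h3, ha, hb, hc⟩
    have h3 : 1 < Mᶜ.card := by
      rw [Finset.card_compl]; omega
    obtain ⟨a, ha, b, hb, hab⟩ := Finset.one_lt_card.1 h3
    simp only [hM, mem_compl, mem_filter, mem_univ, true_and] at ha hb
    exact ⟨a, b, hab, by omega, by omega⟩
  push Not at hPQ
  have hmix3' : ¬ ∃ i j l, i ≠ j ∧ i ≠ l ∧ j ≠ l ∧ (1 ≤ y i ∧ 1 ≤ x i) ∧ (1 ≤ y j ∧ 1 ≤ x j) ∧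
      (1 ≤ y l ∧ 1 ≤ x l) := by
    rintro ⟨i, j, l, h1, h2, h3, a, b, c⟩
    exact hmix3 ⟨i, j, l, h1, h2, h3, a.symm, b.symm, c.symm⟩
  by_cases hyu : y u = 0
  · have h1 : ∀ j, j ≠ u → x j ≠ 0 := fun j hj => hPQ u j hj.symm hyu
    have h2 : y v = 0 := by have := h1 v huv.symm; omega
    have h3 : x u ≠ 0 := hPQ v u huv.symm h2
    refine key x y hz hm hb hd hd1 hY hmix3 (fun i => ?_)
    by_cases hi : i = u
    · subst hi; omega
    · have := h1 i hi; omega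
  · have hxu : x u = 0 := by omega
    have h1 : ∀ j, j ≠ u → y j ≠ 0 := fun j hj h => hPQ j u hj h hxu
    have h2 : x v = 0 := by have := h1 v huv.symm; omega
    refine key y x (fun i => by have := hz i; omega) (fun i a b => hm i b a)
      (fun i a b => hb i b a) hd' hd1' hX hmix3' (fun i => ?_)
    by_cases hi : i = u
    · subst hi; omega
    · have := h1 i hi; omega

section swaps
variable {V : Type*} [Fintype V] [DecidableEq V]

theorem swap_prod_form {g t : Perm V} (hg : g ≠ 1) (ht : t.IsSwap) (hs : (g * t).IsSwap) :
    ∃ p ∈ g.support, t = swap p (g p) := by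
  obtain ⟨a, b, hab, rfl⟩ := ht
  obtain ⟨c, d, hcd, hs⟩ := hs
  have hg' : g = swap c d * swap a b := by rw [← hs, mul_assoc, swap_mul_self, mul_one]
  have ga : g a = swap c d b := by rw [hg']; simp
  have gb : g b = swap c d a := by rw [hg']; simp
  by_cases h1 : b = c ∨ b = d
  · by_cases h2 : a = c ∨ a = d
    · exfalso
      apply hg
      rw [hg']
      rcases h1 with rfl | rfl <;> rcases h2 with rfl | rfl
      · exact absurd rfl hab
      · rw [swap_comm b, swap_mul_self]
      · rw [swap_mul_self]
      · exact absurd rfl hab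
    · push Not at h2
      refine ⟨b, ?_, ?_⟩
      · rw [Perm.mem_support, gb, swap_apply_of_ne_of_ne h2.1 h2.2]; exact hab
      · rw [gb, swap_apply_of_ne_of_ne h2.1 h2.2, swap_comm]
  · push Not at h1
    refine ⟨a, ?_, ?_⟩
    · rw [Perm.mem_support, ga, swap_apply_of_ne_of_ne h1.1 h1.2]; exact hab.symm
    · rw [ga, swap_apply_of_ne_of_ne h1.1 h1.2]

theorem swap_prod_small {g t : Perm V} (ht : t.IsSwap) (hs : (g * t).IsSwap) :
    g.support.card ≤ 3 ∨
      ((univ.filter (fun p => p ∈ g.support)).image (fun p => swap p (g p))).card ≤ 2 := by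
  obtain ⟨a, b, hab, rfl⟩ := ht
  obtain ⟨c, d, hcd, hs⟩ := hs
  have hg' : g = swap c d * swap a b := by rw [← hs, mul_assoc, swap_mul_self, mul_one]
  have hsub : g.support ⊆ {a, b, c, d} := by
    intro p hp
    by_contra h
    simp only [mem_insert, mem_singleton, not_or] at h
    apply Perm.mem_support.1 hp
    rw [hg', Perm.mul_apply, swap_apply_of_ne_of_ne h.1 h.2.1,
      swap_apply_of_ne_of_ne h.2.2.1 h.2.2.2]
  have three : ∀ p q r : V, g.support ⊆ {p, q, r} → g.support.card ≤ 3 := fun p q r h =>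
    (card_le_card h).trans Finset.card_le_three
  by_cases h1 : a = c
  · left; subst h1; apply three a b d; intro p hp; have := hsub hp; simp at this ⊢; tauto
  by_cases h2 : a = d
  · left; subst h2; apply three a b c; intro p hp; have := hsub hp; simp at this ⊢; tauto
  by_cases h3 : b = c
  · left; subst h3; apply three a b d; intro p hp; have := hsub hp; simp at this ⊢; tauto
  by_cases h4 : b = d
  · left; subst h4; apply three a b c; intro p hp; have := hsub hp; simp at this ⊢; tauto
  right
  have : (univ.filter (fun p => p ∈ g.support)).image (fun p => swap p (g p)) ⊆
      {swap a b, swap c d} := by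
    intro t ht
    simp only [mem_image, mem_filter, mem_univ, true_and] at ht
    obtain ⟨p, hp, rfl⟩ := ht
    have hp' := hsub hp
    simp only [mem_insert, mem_singleton] at hp' ⊢
    rcases hp' with rfl | rfl | rfl | rfl
    · left; rw [hg', Perm.mul_apply, swap_apply_left, swap_apply_of_ne_of_ne h3 h4]
    · left; rw [hg', Perm.mul_apply, swap_apply_right, swap_apply_of_ne_of_ne h1 h2, swap_comm]
    · right; rw [hg', Perm.mul_apply, swap_apply_of_ne_of_ne (Ne.symm h1) (Ne.symm h3),
        swap_apply_left]
    · right; rw [hg', Perm.mul_apply, swap_apply_of_ne_of_ne (Ne.symm h2) (Ne.symm h4),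
        swap_apply_right, swap_comm]
  exact (card_le_card this).trans Finset.card_le_two

theorem sol_le3 {g : Perm V} (hg : g ≠ 1) (S : Finset (Perm V))
    (hS : ∀ t ∈ S, t.IsSwap ∧ (g * t).IsSwap) :
    S.card ≤ 3 ∧ (3 ≤ S.card → g.support.card = 3 ∧
      ∀ p ∈ g.support, ∀ q ∈ g.support, p ≠ q → swap p q ∈ S) := by
  have hsub : S ⊆ g.support.image (fun p => swap p (g p)) := by
    intro t ht
    obtain ⟨p, hp, h⟩ := swap_prod_form hg (hS t ht).1 (hS t ht).2
    exact mem_image.2 ⟨p, hp, h.symm⟩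
  have hle := card_le_card hsub
  have himg : (g.support.image (fun p => swap p (g p))).card ≤ g.support.card := card_image_le
  rcases S.eq_empty_or_nonempty with rfl | ⟨t, ht⟩
  · simp
  have hsm := swap_prod_small (hS t ht).1 (hS t ht).2
  have he : (univ.filter (fun p => p ∈ g.support)) = g.support := by ext; simp
  rw [he] at hsm
  refine ⟨by omega, fun h3 => ?_⟩
  have hc : g.support.card = 3 := by omega
  refine ⟨hc, ?_⟩
  have hSeq : S = g.support.image (fun p => swap p (g p)) :=
    Finset.eq_of_subset_of_card_le hsub (by omega)
  intro p hp q hq hpq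
  rw [hSeq, mem_image]
  by_cases h : g p = q
  · exact ⟨p, hp, by rw [h]⟩
  · refine ⟨q, hq, ?_⟩
    have : g q = p := by
      by_contra h'
      have hgp : g p ∈ g.support := Perm.apply_mem_support.2 hp
      have hgq : g q ∈ g.support := Perm.apply_mem_support.2 hq
      have e1 : g p ≠ p := Perm.mem_support.1 hp
      have e2 : g q ≠ q := Perm.mem_support.1 hq
      have e3 : g p ≠ g q := fun h => hpq (g.injective h)
      have : ({p, q, g p, g q} : Finset V) ⊆ g.support := by
        intro r hr
        simp only [mem_insert, mem_singleton] at hr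
        rcases hr with rfl | rfl | rfl | rfl <;> assumption
      have := card_le_card this
      rw [card_insert_of_notMem (by simp [hpq, e1.symm, Ne.symm h']),
        card_insert_of_notMem (by simp [Ne.symm h, e2.symm]), card_pair e3] at this
      omega
    rw [this, swap_comm]

/-- neighbours of `u` -/
def nb (T : Finset (Perm V)) (u : Perm V) : Finset (Perm V) := T.image (fun t => u * t)

theorem mem_nb {T : Finset (Perm V)} {u g : Perm V} : g ∈ nb T u ↔ u⁻¹ * g ∈ T := by
  unfold nb
  rw [mem_image]
  constructor
  · rintro ⟨t, ht, rfl⟩; simpa using ht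
  · intro h; exact ⟨_, h, by simp⟩

theorem card_nb (T : Finset (Perm V)) (u : Perm V) : (nb T u).card = T.card :=
  card_image_of_injective _ (mul_right_injective u)

theorem common_le3 {T : Finset (Perm V)} (hT : ∀ t ∈ T, t.IsSwap) {u v : Perm V} (h : u ≠ v) :
    (nb T u ∩ nb T v).card ≤ 3 := by
  have hg : u⁻¹ * v ≠ 1 := by
    intro h'; exact h (inv_mul_eq_one.1 h')
  have := (sol_le3 hg (T.filter (fun t => u⁻¹ * v * t ∈ T)) (by
    intro t ht; rw [mem_filter] at ht; exact ⟨hT _ ht.1, hT _ ht.2⟩)).1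
  refine le_trans ?_ this
  rw [← card_image_of_injective (T.filter (fun t => u⁻¹ * v * t ∈ T)) (mul_right_injective v)]
  apply card_le_card
  intro g hg
  rw [mem_inter, mem_nb, mem_nb] at hg
  rw [mem_image]
  exact ⟨v⁻¹ * g, mem_filter.2 ⟨hg.2, by simpa [mul_assoc] using hg.1⟩, by simp⟩

theorem union_ge {T : Finset (Perm V)} (hT : ∀ t ∈ T, t.IsSwap) {u v : Perm V} (h : u ≠ v) :
    2 * T.card ≤ (nb T u ∪ nb T v).card + 3 := by
  have := card_union_add_card_inter (nb T u) (nb T v)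
  have := common_le3 hT h
  rw [card_nb, card_nb] at *
  omega

theorem five {T : Finset (Perm V)} (hT : ∀ t ∈ T, t.IsSwap) {u₁ u₂ v : Perm V} (h1 : u₁ ≠ v)
    (h2 : u₂ ≠ v) (h3 : (u₁⁻¹ * u₂).support.card ≤ 3) :
    (nb T v ∩ (nb T u₁ ∪ nb T u₂)).card ≤ 5 := by
  have hg1 : u₁⁻¹ * v ≠ 1 := by
    intro h'; exact h1 (inv_mul_eq_one.1 h')
  have hg2 : u₂⁻¹ * v ≠ 1 := by
    intro h'; exact h2 (inv_mul_eq_one.1 h')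
  set S₁ := T.filter (fun t => u₁⁻¹ * v * t ∈ T) with hS1
  set S₂ := T.filter (fun t => u₂⁻¹ * v * t ∈ T) with hS2
  have k1 := sol_le3 hg1 S₁ (by
    intro t ht; rw [mem_filter] at ht; exact ⟨hT _ ht.1, hT _ ht.2⟩)
  have k2 := sol_le3 hg2 S₂ (by
    intro t ht; rw [mem_filter] at ht; exact ⟨hT _ ht.1, hT _ ht.2⟩)
  have hle : (nb T v ∩ (nb T u₁ ∪ nb T u₂)).card ≤ (S₁ ∪ S₂).card := by
    rw [← card_image_of_injective (S₁ ∪ S₂) (mul_right_injective v)]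
    apply card_le_card
    intro g hg
    rw [mem_inter, mem_union, mem_nb, mem_nb, mem_nb] at hg
    rw [mem_image]
    refine ⟨v⁻¹ * g, mem_union.2 ?_, by simp⟩
    rcases hg.2 with h | h
    · left; exact mem_filter.2 ⟨hg.1, by simpa [mul_assoc] using h⟩
    · right; exact mem_filter.2 ⟨hg.1, by simpa [mul_assoc] using h⟩
  refine hle.trans ?_
  have hU := card_union_add_card_inter S₁ S₂
  by_contra hcon
  have hc1 : 3 ≤ S₁.card := by omega
  have hc2 : 3 ≤ S₂.card := by omega
  have hI : (S₁ ∩ S₂).card = 0 := by omega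
  obtain ⟨d1, f1⟩ := k1.2 hc1
  obtain ⟨d2, f2⟩ := k2.2 hc2
  set g1 := u₁⁻¹ * v with hg1d
  set g2 := u₂⁻¹ * v with hg2d
  have hrho : u₁⁻¹ * u₂ = g1 * g2⁻¹ := by rw [hg1d, hg2d]; group
  rw [hrho] at h3
  have hsd : (g1.support \ g2.support) ∪ (g2.support \ g1.support) ⊆ (g1 * g2⁻¹).support := by
    intro p hp
    rw [mem_union, mem_sdiff, mem_sdiff] at hp
    rcases hp with ⟨a, b⟩ | ⟨a, b⟩
    · rw [Perm.mem_support] at a ⊢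
      rw [Perm.notMem_support] at b
      have : g2⁻¹ p = p := by rw [Perm.inv_eq_iff_eq]; exact b.symm
      rw [Perm.mul_apply, this]; exact a
    · rw [← Perm.support_inv]
      rw [Perm.mem_support] at a ⊢
      rw [Perm.notMem_support] at b
      have : g1⁻¹ p = p := by rw [Perm.inv_eq_iff_eq]; exact b.symm
      rw [mul_inv_rev, inv_inv, Perm.mul_apply, this]; exact a
  have hcard := card_le_card hsd
  rw [card_union_of_disjoint (by
    rw [Finset.disjoint_left]; intro p hp hq; rw [mem_sdiff] at hp hq; exact hp.2 hq.1)] at hcard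
  have e1 := card_sdiff_add_card_inter g1.support g2.support
  have e2 := card_sdiff_add_card_inter g2.support g1.support
  rw [inter_comm] at e2
  have : 1 < (g1.support ∩ g2.support).card := by omega
  obtain ⟨p, hp, q, hq, hpq⟩ := one_lt_card.1 this
  rw [mem_inter] at hp hq
  have := mem_inter.2 ⟨f1 p hp.1 q hq.1 hpq, f2 p hp.2 q hq.2 hpq⟩
  rw [card_eq_zero] at hI
  rw [hI] at this
  simp at this

end swaps

section counts
variable {V : Type*} [Fintype V] [DecidableEq V]

theorem sign_isSwap {t : Perm V} (h : t.IsSwap) : Perm.sign t = -1 := h.sign_eq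

theorem isSwap_mul_self {t : Perm V} (h : t.IsSwap) : t * t = 1 := by
  obtain ⟨a, b, -, rfl⟩ := h; exact swap_mul_self a b

theorem pt_count (hV : 3 ≤ Fintype.card V) (w j : V) (s : ℤˣ) :
    2 * (univ.filter (fun g : Perm V => g w = j ∧ Perm.sign g = s)).card * Fintype.card V
      = (Fintype.card V).factorial := by
  have h1 : ∀ s : ℤˣ, (univ.filter (fun g : Perm V => g w = j ∧ Perm.sign g = s)).card
      ≤ (univ.filter (fun g : Perm V => g w = j ∧ Perm.sign g = -s)).card := by
    intro s
    have : 1 < (univ.erase w : Finset V).card := by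
      rw [card_erase_of_mem (mem_univ w), card_univ]; omega
    obtain ⟨a, ha, b, hb, hab⟩ := one_lt_card.1 this
    simp only [mem_erase, mem_univ, and_true] at ha hb
    apply card_le_card_of_injOn (fun g => g * swap a b)
    · intro g hg
      simp only [coe_filter, mem_univ, true_and, Set.mem_setOf_eq] at hg ⊢
      refine ⟨?_, ?_⟩
      · rw [Perm.mul_apply, swap_apply_of_ne_of_ne (Ne.symm ha) (Ne.symm hb)]; exact hg.1
      · rw [Perm.sign_mul, Perm.sign_swap hab, hg.2]; simp
    · intro g _ h _ hgh; exact mul_right_cancel hgh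
  have h2 : ∀ j : V, (univ.filter (fun g : Perm V => g w = j ∧ Perm.sign g = s)).card +
      (univ.filter (fun g : Perm V => g w = j ∧ Perm.sign g = -s)).card =
      (univ.filter (fun g : Perm V => g w = j)).card := by
    intro j
    rw [← card_union_of_disjoint]
    · congr 1
      ext g
      simp only [mem_union, mem_filter, mem_univ, true_and]
      rcases Int.units_eq_one_or (Perm.sign g) with h | h <;>
        rcases Int.units_eq_one_or s with h' | h' <;> simp [h, h']
    · rw [Finset.disjoint_left]
      intro g hg hg'
      simp only [mem_filter, mem_univ, true_and] at hg hg'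
      have := hg.2.symm.trans hg'.2
      rcases Int.units_eq_one_or s with h' | h' <;> simp [h'] at this
  have h3 : ∀ j' : V, (univ.filter (fun g : Perm V => g w = j')).card =
      (univ.filter (fun g : Perm V => g w = j)).card := by
    intro j'
    apply card_bij (fun g _ => swap j j' * g)
    · intro g hg
      simp only [mem_filter, mem_univ, true_and] at hg ⊢
      rw [Perm.mul_apply, hg, swap_apply_right]
    · intro g _ h _ hgh; exact mul_left_cancel hgh
    · intro g hg
      simp only [mem_filter, mem_univ, true_and] at hg
      refine ⟨swap j j' * g, ?_, by rw [← mul_assoc, swap_mul_self, one_mul]⟩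
      simp only [mem_filter, mem_univ, true_and]
      rw [Perm.mul_apply, hg, swap_apply_left]
  have h4 : Fintype.card (Perm V) = ∑ j' : V, (univ.filter (fun g : Perm V => g w = j')).card := by
    rw [← card_univ]
    exact card_eq_sum_card_fiberwise (fun g _ => mem_univ (g w))
  rw [Fintype.card_perm, Finset.sum_congr rfl (fun j' _ => h3 j'), sum_const, card_univ,
    smul_eq_mul] at h4
  have a1 := h1 s
  have a2 := h1 (-s)
  rw [neg_neg] at a2
  have a3 := h2 j
  rw [h4, ← a3, mul_comm]
  congr 1
  omega

def NoE (T X Y : Finset (Perm V)) : Prop := ∀ x ∈ X, ∀ t ∈ T, x * t ∉ Y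

theorem NoE.symm {T X Y : Finset (Perm V)} (hT : ∀ t ∈ T, t.IsSwap) (h : NoE T X Y) :
    NoE T Y X := by
  intro y hy t ht hx
  have := h _ hx t ht
  rw [mul_assoc, isSwap_mul_self (hT t ht), mul_one] at this
  exact this hy

def Hole (T : Finset (Perm V)) (c : ℕ) : Prop :=
  ∀ s : ℤˣ, ∀ X Y : Finset (Perm V), (∀ x ∈ X, Perm.sign x = s) → (∀ y ∈ Y, Perm.sign y = -s) →
    NoE T X Y → 2 ≤ X.card → 2 ≤ Y.card →
    2 * (X.card + Y.card) + 4 * T.card ≤ (Fintype.card V).factorial + c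

end counts

section step
variable {W : Type*} [Fintype W] [DecidableEq W]

/-- the embedding of `Perm W` onto the copy of permutations sending `none` to `i` -/
def cpy (i : Option W) (σ : Perm W) : Perm (Option W) := swap none i * optionCongr σ

theorem cpy_none (i : Option W) (σ : Perm W) : cpy i σ none = i := by
  simp [cpy]

theorem cpy_some (i : Option W) (σ : Perm W) (w : W) :
    cpy i σ (some w) = swap none i (some (σ w)) := by
  simp [cpy]

theorem oc_mul (σ τ : Perm W) : (optionCongr (σ * τ) : Perm (Option W)) =
    (optionCongr σ : Perm (Option W)) * (optionCongr τ : Perm (Option W)) := by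
  ext x : 1
  cases x <;> simp

theorem cpy_mul (i : Option W) (σ τ : Perm W) : cpy i (σ * τ) =
    cpy i σ * (optionCongr τ : Perm (Option W)) := by
  rw [cpy, cpy, oc_mul, mul_assoc]

theorem cpy_inj (i : Option W) : Function.Injective (cpy i) := by
  intro σ τ h
  exact optionCongr_injective (mul_left_cancel h)

theorem cpy_surj (g : Perm (Option W)) : ∃ σ, g = cpy (g none) σ := by
  have h := Perm.decomposeOption.symm_apply_apply g
  refine ⟨(Perm.decomposeOption g).2, ?_⟩
  conv_lhs => rw [← h]
  rfl

theorem sign_cpy (i : Option W) (σ : Perm W) :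
    Perm.sign (cpy i σ) = Perm.sign (swap none i) * Perm.sign σ := by
  rw [cpy, Perm.sign_mul, optionCongr_sign]

/-- the part of `X` in copy `i` -/
def fib (X : Finset (Perm (Option W))) (i : Option W) : Finset (Perm (Option W)) :=
  X.filter (fun g => g none = i)

theorem mem_fib {X : Finset (Perm (Option W))} {i : Option W} {g : Perm (Option W)} :
    g ∈ fib X i ↔ g ∈ X ∧ g none = i := mem_filter

theorem card_eq_sum_fib (X : Finset (Perm (Option W))) : X.card = ∑ i, (fib X i).card :=
  card_eq_sum_card_fiberwise (fun g _ => mem_univ (g none))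

def pull (X : Finset (Perm (Option W))) (i : Option W) : Finset (Perm W) :=
  univ.filter (fun σ => cpy i σ ∈ X)

theorem card_pull (X : Finset (Perm (Option W))) (i : Option W) :
    (pull X i).card = (fib X i).card := by
  apply card_bij (fun σ _ => cpy i σ)
  · intro σ hσ
    simp only [pull, mem_filter, mem_univ, true_and] at hσ
    exact mem_fib.2 ⟨hσ, cpy_none i σ⟩
  · intro σ _ τ _ h; exact cpy_inj i h
  · intro g hg
    rw [mem_fib] at hg
    obtain ⟨σ, hσ⟩ := cpy_surj g
    rw [hg.2] at hσ
    exact ⟨σ, by simp only [pull, mem_filter, mem_univ, true_and]; rw [← hσ]; exact hg.1, hσ.symm⟩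

def sgn (W : Type*) [Fintype W] [DecidableEq W] (s : ℤˣ) : Finset (Perm (Option W)) :=
  univ.filter (fun g => Perm.sign g = s)

theorem mem_sgn {s : ℤˣ} {g : Perm (Option W)} : g ∈ sgn W s ↔ Perm.sign g = s := by
  simp [sgn]

theorem card_fib_sgn (hW : 2 ≤ Fintype.card W) (i : Option W) (s : ℤˣ) :
    2 * (fib (sgn W s) i).card = (Fintype.card W).factorial := by
  have h := pt_count (V := Option W) (by rw [Fintype.card_option]; omega) none i s
  have e : fib (sgn W s) i =
      univ.filter (fun g : Perm (Option W) => g none = i ∧ Perm.sign g = s) := by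
    ext g; simp [mem_fib, mem_sgn, and_comm]
  rw [e]
  rw [Fintype.card_option, Nat.factorial_succ, mul_comm (_ + 1)] at h
  exact Nat.eq_of_mul_eq_mul_right (Nat.succ_pos _) h

theorem card_two (hW : 3 ≤ Fintype.card W) (i j : Option W) (hij : i ≠ j) (w : W) (s : ℤˣ) :
    2 * (univ.filter (fun g : Perm (Option W) => g none = i ∧ g (some w) = j ∧
      Perm.sign g = s)).card * Fintype.card W = (Fintype.card W).factorial := by
  obtain ⟨j', hj'⟩ : ∃ j', swap none i j = some j' := by
    rw [← Option.ne_none_iff_exists']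
    intro h
    rw [swap_apply_eq_iff, swap_apply_left] at h
    exact hij h.symm
  rw [← pt_count hW w j' (Perm.sign (swap none i) * s)]
  congr 2
  symm
  apply card_bij (fun σ _ => cpy i σ)
  · intro σ hσ
    simp only [mem_filter, mem_univ, true_and] at hσ ⊢
    refine ⟨cpy_none i σ, ?_, ?_⟩
    · rw [cpy_some, hσ.1, ← hj', swap_apply_self]
    · rw [sign_cpy, hσ.2, ← mul_assoc, Int.units_mul_self, one_mul]
  · intro σ _ τ _ h; exact cpy_inj i h
  · intro g hg
    simp only [mem_filter, mem_univ, true_and] at hg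
    obtain ⟨σ, hσ⟩ := cpy_surj g
    rw [hg.1] at hσ
    refine ⟨σ, ?_, hσ.symm⟩
    simp only [mem_filter, mem_univ, true_and]
    subst hσ
    refine ⟨?_, ?_⟩
    · have := hg.2.1
      rw [cpy_some, swap_apply_eq_iff, hj'] at this
      exact Option.some_injective _ this
    · rw [← hg.2.2, sign_cpy, ← mul_assoc, Int.units_mul_self, one_mul]

/-- generators on `Option W` -/
def ext (T : Finset (Perm W)) (D : Finset W) : Finset (Perm (Option W)) :=
  T.image (fun t => (optionCongr t : Perm (Option W))) ∪ D.image (fun w => swap none (some w))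

theorem oc_mem_ext {T : Finset (Perm W)} {D : Finset W} {t : Perm W} (h : t ∈ T) :
    (optionCongr t : Perm (Option W)) ∈ ext T D :=
  mem_union_left _ (mem_image_of_mem _ h)

theorem sw_mem_ext {T : Finset (Perm W)} {D : Finset W} {w : W} (h : w ∈ D) :
    swap none (some w) ∈ ext T D :=
  mem_union_right _ (mem_image_of_mem (fun w => swap none (some w)) h)

theorem ext_isSwap {T : Finset (Perm W)} {D : Finset W} (hT : ∀ t ∈ T, t.IsSwap) :
    ∀ t ∈ ext T D, t.IsSwap := by
  intro t ht
  rcases mem_union.1 ht with h | h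
  · obtain ⟨t', h', rfl⟩ := mem_image.1 h
    obtain ⟨a, b, hab, rfl⟩ := hT t' h'
    exact ⟨some a, some b, by simpa using hab, by rw [optionCongr_swap]⟩
  · obtain ⟨w, -, rfl⟩ := mem_image.1 h
    exact ⟨none, some w, by simp, rfl⟩

theorem card_ext (T : Finset (Perm W)) (D : Finset W) : (ext T D).card = T.card + D.card := by
  rw [ext, card_union_of_disjoint, card_image_of_injective _ optionCongr_injective,
    card_image_of_injective]
  · intro a b h
    have := congrArg (fun g : Perm (Option W) => g none) h
    simpa using this
  · rw [Finset.disjoint_left]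
    intro g hg hg'
    obtain ⟨t, -, rfl⟩ := mem_image.1 hg
    obtain ⟨w, -, h⟩ := mem_image.1 hg'
    have := congrArg (fun g : Perm (Option W) => g none) h
    simp at this

variable {T : Finset (Perm W)} {D : Finset W} {X Y : Finset (Perm (Option W))} {s : ℤˣ}

theorem fib_le (hX : ∀ x ∈ X, Perm.sign x = s) (i : Option W) :
    (fib X i).card ≤ (fib (sgn W s) i).card :=
  card_le_card (fun g hg => mem_fib.2 ⟨mem_sgn.2 (hX g (mem_fib.1 hg).1), (mem_fib.1 hg).2⟩)

/-- complement in the sign class -/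
theorem card_compl_fib (hX : ∀ x ∈ X, Perm.sign x = s) (i : Option W) :
    (fib (sgn W s \ X) i).card + (fib X i).card = (fib (sgn W s) i).card := by
  rw [← card_union_of_disjoint]
  · congr 1
    ext g
    simp only [mem_union, mem_fib, mem_sdiff, mem_sgn]
    constructor
    · rintro (⟨⟨a, _⟩, b⟩ | ⟨a, b⟩)
      · exact ⟨a, b⟩
      · exact ⟨hX g a, b⟩
    · rintro ⟨a, b⟩
      by_cases h : g ∈ X
      · right; exact ⟨h, b⟩
      · left; exact ⟨⟨a, h⟩, b⟩
  · rw [Finset.disjoint_left]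
    intro g hg hg'
    rw [mem_fib, mem_sdiff] at hg
    exact hg.1.2 (mem_fib.1 hg').1

theorem F1 (hT : ∀ t ∈ T, t.IsSwap) (hX : ∀ x ∈ X, Perm.sign x = s)
    (hY : ∀ y ∈ Y, Perm.sign y = -s) (h : NoE (ext T D) Y X) (i : Option W)
    (hy : 1 ≤ (fib Y i).card) : (fib X i).card + T.card ≤ (fib (sgn W s) i).card := by
  obtain ⟨y, hy⟩ := card_pos.1 hy
  rw [mem_fib] at hy
  rw [← card_compl_fib hX i, add_comm]
  apply Nat.add_le_add_right
  apply card_le_card_of_injOn (fun t => y * (optionCongr t : Perm (Option W)))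
  · intro t ht
    refine mem_fib.2 ⟨mem_sdiff.2 ⟨mem_sgn.2 ?_, h y hy.1 _ (oc_mem_ext ht)⟩, ?_⟩
    · rw [Perm.sign_mul, optionCongr_sign, hY y hy.1, sign_isSwap (hT t ht)]; simp
    · simpa using hy.2
  · intro a _ b _ hab
    exact optionCongr_injective (mul_left_cancel hab)

theorem F2 (hW : 2 ≤ Fintype.card W) (hH : Hole T 12) (hX : ∀ x ∈ X, Perm.sign x = s)
    (hY : ∀ y ∈ Y, Perm.sign y = -s) (h : NoE (ext T D) X Y) (i : Option W)
    (hx : 2 ≤ (fib X i).card) (hy : 2 ≤ (fib Y i).card) :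
    (fib X i).card + (fib Y i).card + 2 * T.card ≤ (fib (sgn W s) i).card + 6 := by
  have := hH (Perm.sign (swap none i) * s) (pull X i) (pull Y i) (by
      intro σ hσ
      simp only [pull, mem_filter, mem_univ, true_and] at hσ
      rw [← hX _ hσ, sign_cpy, ← mul_assoc, Int.units_mul_self, one_mul]) (by
      intro σ hσ
      simp only [pull, mem_filter, mem_univ, true_and] at hσ
      rw [← mul_neg, ← hY _ hσ, sign_cpy, ← mul_assoc, Int.units_mul_self, one_mul]) (by
      intro σ hσ t ht hy
      simp only [pull, mem_filter, mem_univ, true_and] at hσ hy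
      rw [cpy_mul] at hy
      exact h _ hσ _ (oc_mem_ext ht) hy) (by rwa [card_pull]) (by rwa [card_pull])
  rw [card_pull, card_pull, ← card_fib_sgn hW i s] at this
  omega

theorem F3 (hX : ∀ x ∈ X, Perm.sign x = s)
    (hY : ∀ y ∈ Y, Perm.sign y = -s) (h : NoE (ext T D) X Y) (i j : Option W) (hij : i ≠ j)
    (c : ℕ) (hc : ∀ w, (univ.filter (fun g : Perm (Option W) => g none = i ∧ g (some w) = j ∧
      Perm.sign g = s)).card = c) :
    (fib X i).card + (fib Y j).card + D.card * c ≤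
      (fib (sgn W s) i).card + (fib (sgn W (-s)) j).card := by
  set E := D.sigma (fun w => univ.filter (fun g : Perm (Option W) => g none = i ∧ g (some w) = j ∧
      Perm.sign g = s)) with hE
  have hEc : E.card = D.card * c := by
    rw [hE, card_sigma, sum_congr rfl (fun w _ => hc w), sum_const, smul_eq_mul]
  have mE : ∀ p ∈ E, p.1 ∈ D ∧ p.2 none = i ∧ p.2 (some p.1) = j ∧ Perm.sign p.2 = s := by
    intro p hp
    simpa [hE] using hp
  have h1 : (E.filter (fun p => p.2 ∉ X)).card ≤ (fib (sgn W s \ X) i).card := by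
    apply card_le_card_of_injOn (fun p => p.2)
    · intro p hp
      have hp := mem_filter.1 hp
      have := mE p hp.1
      exact mem_fib.2 ⟨mem_sdiff.2 ⟨mem_sgn.2 this.2.2.2, hp.2⟩, this.2.1⟩
    · rintro ⟨w, g⟩ hp ⟨w', g'⟩ hq hpq
      have a := mE _ (mem_filter.1 hp).1
      have b := mE _ (mem_filter.1 hq).1
      simp only at a b hpq
      subst hpq
      have : w = w' := Option.some_injective _ (g.injective (a.2.2.1.trans b.2.2.1.symm))
      subst this; rfl
  have h2 : (E.filter (fun p => ¬ p.2 ∉ X)).card ≤ (fib (sgn W (-s) \ Y) j).card := by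
    apply card_le_card_of_injOn (fun p => p.2 * swap none (some p.1))
    · intro p hp
      have hp := mem_filter.1 hp
      have := mE p hp.1
      refine mem_fib.2 ⟨mem_sdiff.2 ⟨mem_sgn.2 ?_, h _ (not_not.1 hp.2) _ (sw_mem_ext this.1)⟩, ?_⟩
      · rw [Perm.sign_mul, this.2.2.2, Perm.sign_swap (by simp)]; simp
      · rw [Perm.mul_apply, swap_apply_left]; exact this.2.2.1
    · rintro ⟨w, g⟩ hp ⟨w', g'⟩ hq hpq
      have a := mE _ (mem_filter.1 hp).1
      have b := mE _ (mem_filter.1 hq).1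
      simp only at a b hpq
      have e1 : (g * swap none (some w)) (some w) = i := by
        rw [Perm.mul_apply, swap_apply_right]; exact a.2.1
      have e2 : (g' * swap none (some w')) (some w') = i := by
        rw [Perm.mul_apply, swap_apply_right]; exact b.2.1
      rw [← hpq] at e2
      have : w = w' := Option.some_injective _ ((g * swap none (some w)).injective (e1.trans e2.symm))
      subst this
      rw [mul_right_cancel hpq]
  have h3 := card_filter_add_card_filter_not (s := E) (fun p => p.2 ∉ X)
  have h4 := card_compl_fib hX i
  have h5 := card_compl_fib hY j
  omega

theorem F4 (hX : ∀ x ∈ X, Perm.sign x = s)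
    (hY : ∀ y ∈ Y, Perm.sign y = -s) (h : NoE (ext T D) Y X) (i j : Option W)
    (r : ℕ) (hr : ∀ y ∈ fib Y i, r ≤ (D.filter (fun w => y (some w) ≠ j)).card) :
    (fib Y i).card * r ≤ ∑ k ∈ univ.filter (fun k => k ≠ i ∧ k ≠ j),
      (fib (sgn W s \ X) k).card := by
  set E := (fib Y i).sigma (fun y => D.filter (fun w => y (some w) ≠ j)) with hE
  have hEc : (fib Y i).card * r ≤ E.card := by
    rw [hE, card_sigma, ← smul_eq_mul, ← sum_const]
    exact sum_le_sum hr
  have mE : ∀ p ∈ E, (p.1 ∈ Y ∧ p.1 none = i) ∧ p.2 ∈ D ∧ p.1 (some p.2) ≠ j := by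
    intro p hp
    simpa [hE, mem_fib] using hp
  refine hEc.trans ?_
  have h1 : ((sgn W s \ X).filter (fun g => g none ≠ i ∧ g none ≠ j)).card =
      ∑ k ∈ univ.filter (fun k => k ≠ i ∧ k ≠ j), (fib (sgn W s \ X) k).card := by
    rw [card_eq_sum_card_fiberwise (f := fun g : Perm (Option W) => g none)
      (t := univ.filter (fun k => k ≠ i ∧ k ≠ j))]
    · apply sum_congr rfl
      intro k hk
      simp only [mem_filter, mem_univ, true_and] at hk
      congr 1
      ext g
      simp only [mem_filter, mem_fib]
      constructor
      · rintro ⟨⟨a, _⟩, b⟩; exact ⟨a, b⟩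
      · rintro ⟨a, b⟩; exact ⟨⟨a, by rw [b]; exact hk⟩, b⟩
    · intro g hg
      have := (mem_filter.1 hg).2
      simpa using this
  rw [← h1]
  apply card_le_card_of_injOn (fun p => p.1 * swap none (some p.2))
  · intro p hp
    have a := mE p hp
    have e0 : (p.1 * swap none (some p.2)) none = p.1 (some p.2) := by
      rw [Perm.mul_apply, swap_apply_left]
    refine mem_filter.2 ⟨mem_sdiff.2 ⟨mem_sgn.2 ?_, h _ a.1.1 _ (sw_mem_ext a.2.1)⟩, ?_, ?_⟩
    · rw [Perm.sign_mul, hY _ a.1.1, Perm.sign_swap (by simp)]; simp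
    · simp only [e0]
      intro hh
      have := p.1.injective (hh.trans a.1.2.symm)
      simp at this
    · simp only [e0]; exact a.2.2
  · rintro ⟨g, w⟩ hp ⟨g', w'⟩ hq hpq
    have a := mE _ hp
    have b := mE _ hq
    simp only at a b hpq
    have e1 : (g * swap none (some w)) (some w) = i := by
      rw [Perm.mul_apply, swap_apply_right]; exact a.1.2
    have e2 : (g' * swap none (some w')) (some w') = i := by
      rw [Perm.mul_apply, swap_apply_right]; exact b.1.2
    rw [← hpq] at e2
    have : w = w' := Option.some_injective _ ((g * swap none (some w)).injective (e1.trans e2.symm))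
    subst this
    rw [mul_right_cancel hpq]

theorem F4a (hX : ∀ x ∈ X, Perm.sign x = s)
    (hY : ∀ y ∈ Y, Perm.sign y = -s) (h : NoE (ext T D) Y X) (i : Option W) :
    (fib Y i).card * D.card ≤ ∑ k ∈ univ.filter (fun k => k ≠ i), (fib (sgn W s \ X) k).card := by
  have := F4 hX hY h i i D.card (fun y hy => by
    rw [filter_true_of_mem]
    intro w _ hw
    have := y.injective (hw.trans (mem_fib.1 hy).2.symm)
    simp at this)
  simpa using this

theorem F4b (hX : ∀ x ∈ X, Perm.sign x = s)
    (hY : ∀ y ∈ Y, Perm.sign y = -s) (h : NoE (ext T D) Y X) (i j : Option W) :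
    (fib Y i).card * (D.card - 1) ≤ ∑ k ∈ univ.filter (fun k => k ≠ i ∧ k ≠ j),
      (fib (sgn W s \ X) k).card := by
  refine F4 hX hY h i j (D.card - 1) (fun y hy => ?_)
  have h1 := card_filter_add_card_filter_not (s := D) (fun w => y (some w) ≠ j)
  have h2 : (D.filter (fun w => ¬ y (some w) ≠ j)).card ≤ 1 := by
    rw [card_le_one]
    intro a ha b hb
    simp only [mem_filter, not_not] at ha hb
    exact Option.some_injective _ (y.injective (ha.2.trans hb.2.symm))
  omega

theorem F5 {V : Type*} [Fintype V] [DecidableEq V] {T X Y : Finset (Perm V)} {s : ℤˣ}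
    (hV : 2 ≤ Fintype.card V)
    (hT : ∀ t ∈ T, t.IsSwap) (hX : ∀ x ∈ X, Perm.sign x = s)
    (hY : ∀ y ∈ Y, Perm.sign y = -s) (h : NoE T Y X) (h2 : Y.card = 2) :
    2 * (X.card + Y.card) + 4 * T.card ≤ (Fintype.card V).factorial + 10 := by
  obtain ⟨u, v, huv, rfl⟩ := card_eq_two.1 h2
  have h1 := union_ge hT huv
  have hN : 2 * (univ.filter (fun g : Perm V => Perm.sign g = s)).card ≤
      (Fintype.card V).factorial := by
    rw [← Fintype.card_perm, ← card_univ]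
    have : (univ.filter (fun g : Perm V => Perm.sign g = s)).card ≤
        (univ.filter (fun g : Perm V => ¬ Perm.sign g = s)).card := by
      obtain ⟨a, b, hab⟩ := Fintype.exists_pair_of_one_lt_card (α := V) (by omega)
      apply card_le_card_of_injOn (fun g => g * swap a b)
      · intro g hg
        simp only [coe_filter, mem_univ, true_and, Set.mem_setOf_eq] at hg ⊢
        rw [Perm.sign_mul, Perm.sign_swap hab, hg]
        rcases Int.units_eq_one_or s with h' | h' <;> simp [h'] <;> decide
      · intro g _ h _ hgh; exact mul_right_cancel hgh
    have := card_filter_add_card_filter_not (s := (univ : Finset (Perm V)))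
      (fun g => Perm.sign g = s)
    omega
  have h3 : (X ∪ (nb T u ∪ nb T v)).card ≤
      (univ.filter (fun g : Perm V => Perm.sign g = s)).card := by
    apply card_le_card
    intro g hg
    simp only [mem_filter, mem_univ, true_and]
    rw [mem_union, mem_union] at hg
    rcases hg with hg | hg | hg
    · exact hX g hg
    · obtain ⟨t, ht, rfl⟩ := mem_image.1 hg
      rw [Perm.sign_mul, hY u (by simp), sign_isSwap (hT t ht)]; simp
    · obtain ⟨t, ht, rfl⟩ := mem_image.1 hg
      rw [Perm.sign_mul, hY v (by simp), sign_isSwap (hT t ht)]; simp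
  rw [card_union_of_disjoint] at h3
  · omega
  · rw [Finset.disjoint_right]
    intro g hg
    rw [mem_union] at hg
    rcases hg with hg | hg
    · obtain ⟨t, ht, rfl⟩ := mem_image.1 hg
      exact h u (by simp) t ht
    · obtain ⟨t, ht, rfl⟩ := mem_image.1 hg
      exact h v (by simp) t ht

end step

section steps
variable {W : Type*} [Fintype W] [DecidableEq W]
variable {T : Finset (Perm W)} {D : Finset W} {X Y : Finset (Perm (Option W))} {s : ℤˣ}

theorem fact_aux (w : ℕ) (hw : 4 ≤ w) : 2 * (w * (w - 1)) ≤ w.factorial := by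
  obtain ⟨v, rfl⟩ := Nat.exists_eq_add_of_le hw
  have h1 : (4 + v).factorial = (4 + v) * ((3 + v) * ((2 + v).factorial)) := by
    rw [show 4 + v = (3 + v) + 1 by omega, Nat.factorial_succ, show 3 + v = (2 + v) + 1 by omega,
      Nat.factorial_succ]
  have h2 : 2 ≤ (2 + v).factorial := Nat.factorial_le (show 2 ≤ 2 + v by omega)
  rw [h1, show 4 + v - 1 = 3 + v by omega]
  nlinarith [Nat.mul_le_mul_left ((4 + v) * (3 + v)) h2]

/-- sizes of the two parts in one copy -/
theorem F0 (hT : ∀ t ∈ T, t.IsSwap) (hne : T.Nonempty) (hX : ∀ x ∈ X, Perm.sign x = s)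
    (hY : ∀ y ∈ Y, Perm.sign y = -s) (h : NoE (ext T D) Y X) (i : Option W) :
    (fib X i).card + (fib Y i).card ≤ (fib (sgn W s) i).card := by
  obtain ⟨t, ht⟩ := hne
  rw [← card_compl_fib hX i, add_comm]
  apply Nat.add_le_add_right
  apply card_le_card_of_injOn (fun y => y * (optionCongr t : Perm (Option W)))
  · intro y hy
    have hy := mem_fib.1 hy
    refine mem_fib.2 ⟨mem_sdiff.2 ⟨mem_sgn.2 ?_, h y hy.1 _ (oc_mem_ext ht)⟩, ?_⟩
    · rw [Perm.sign_mul, hY y hy.1, optionCongr_sign, sign_isSwap (hT t ht)]; simp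
    · simp [hy.2]
  · intro a _ b _ hab; exact mul_right_cancel hab

theorem Hole.mono {V : Type*} [Fintype V] [DecidableEq V] {T : Finset (Perm V)} {c c' : ℕ}
    (h : Hole T c) (hc : c ≤ c') : Hole T c' := by
  intro s X Y hX hY hN h1 h2
  have := h s X Y hX hY hN h1 h2
  omega

theorem pre_step (hW : 3 ≤ Fintype.card W) (hT : ∀ t ∈ T, t.IsSwap) (hne : T.Nonempty)
    (hX : ∀ x ∈ X, Perm.sign x = s)
    (hY : ∀ y ∈ Y, Perm.sign y = -s) (h : NoE (ext T D) X Y) :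
    ∃ (N c : ℕ) (z : Option W → ℕ), 2 * N = (Fintype.card W).factorial ∧
      N = c * Fintype.card W ∧
      (∀ i, (fib (sgn W s) i).card = N) ∧
      (∀ i, (fib X i).card + (fib Y i).card + z i = N) ∧
      (∀ i j, i ≠ j → (fib X i).card + (fib Y j).card + D.card * c ≤ 2 * N) ∧
      (∀ i, (fib (sgn W s \ X) i).card = (fib Y i).card + z i) ∧
      (∀ i, (fib (sgn W (-s) \ Y) i).card = (fib X i).card + z i) ∧
      (∀ i, 1 ≤ (fib X i).card → (fib Y i).card + T.card ≤ N) ∧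
      (∀ i, 1 ≤ (fib Y i).card → (fib X i).card + T.card ≤ N) ∧
      X.card + Y.card + ∑ i, z i = (Fintype.card W + 1) * N := by
  have hs := h.symm (ext_isSwap hT)
  have hf := fun i s => card_fib_sgn (W := W) (by omega) i s
  set N := (fib (sgn W s) none).card with hN
  have hNs : ∀ i s', (fib (sgn W s') i).card = N := by
    intro i s'
    have := hf i s'; have := hf none s; omega
  have hwpos : ∃ w : W, True := by
    obtain ⟨w⟩ := Fintype.card_pos_iff.1 (show 0 < Fintype.card W by omega)
    exact ⟨w, trivial⟩
  obtain ⟨w0, -⟩ := hwpos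
  set c := (univ.filter (fun g : Perm (Option W) => g none = none ∧ g (some w0) = some w0 ∧
      Perm.sign g = s)).card with hc
  have hct : 2 * c * Fintype.card W = (Fintype.card W).factorial :=
    card_two hW none (some w0) (by simp) w0 s
  have hcc : ∀ i j : Option W, i ≠ j → ∀ w, (univ.filter (fun g : Perm (Option W) => g none = i ∧
      g (some w) = j ∧ Perm.sign g = s)).card = c := by
    intro i j hij w
    have h1 := card_two hW i j hij w s
    have h2 := Nat.eq_of_mul_eq_mul_right (by omega) (h1.trans hct.symm)
    omega
  have hz : ∀ i, (fib X i).card + (fib Y i).card + (N - (fib X i).card - (fib Y i).card) = N := by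
    intro i
    have := F0 hT hne hX hY hs i
    rw [hNs] at this
    omega
  have hYn : ∀ x ∈ X, Perm.sign x = - -s := by simpa using hX
  refine ⟨N, c, fun i => N - (fib X i).card - (fib Y i).card, hf none s, ?_, fun i => hNs i s, hz,
    ?_, ?_, ?_, ?_, ?_, ?_⟩
  · have := hf none s
    rw [← hct] at this
    rw [mul_assoc] at this
    omega
  · intro i j hij
    have := F3 hX hY h i j hij c (hcc i j hij)
    rw [hNs, hNs] at this
    omega
  · intro i
    have h1 := card_compl_fib hX i
    rw [hNs] at h1
    have := hz i
    simp only
    omega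
  · intro i
    have h1 := card_compl_fib hY i
    rw [hNs] at h1
    have := hz i
    simp only
    omega
  · intro i hi
    have := F1 hT hY hYn h i hi
    rwa [hNs] at this
  · intro i hi
    have := F1 hT hX hY hs i hi
    rwa [hNs] at this
  · rw [card_eq_sum_fib X, card_eq_sum_fib Y, ← sum_add_distrib, ← sum_add_distrib,
      sum_congr rfl (fun i _ => hz i), sum_const, card_univ, Fintype.card_option, smul_eq_mul]

theorem step_strong (hW : 4 ≤ Fintype.card W) (hT : ∀ t ∈ T, t.IsSwap) (hH : Hole T 12)
    (hD : 2 ≤ D.card) (hm5 : 5 ≤ T.card) (hDT : 2 * D.card ≤ T.card + 2)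
    (hTc : 2 * T.card ≤ Fintype.card W * (Fintype.card W - 1)) : Hole (ext T D) 10 := by
  intro s X Y hX hY h h1 h2
  have hE := ext_isSwap (D := D) hT
  have hs := h.symm hE
  have hYn : ∀ x ∈ X, Perm.sign x = - -s := by simpa using hX
  by_cases hY2 : Y.card = 2
  · exact F5 (by rw [Fintype.card_option]; omega) hE hX hY hs hY2
  by_cases hX2 : X.card = 2
  · have := F5 (by rw [Fintype.card_option]; omega) hE hY hYn h hX2
    omega
  obtain ⟨N, c, z, hN, hNc, hNs, hz, hc, hyz, hxz, hx1, hy1, htot⟩ :=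
    pre_step (by omega) hT (card_pos.1 (by omega)) hX hY h
  have hfa := fact_aux _ hW
  have hsc : ∀ k, (fib Y k).card + z k = (fib (sgn W s \ X) k).card := fun k => (hyz k).symm
  have hsc' : ∀ k, (fib X k).card + z k = (fib (sgn W (-s) \ Y) k).card := fun k => (hxz k).symm
  have hb : ∀ i, 2 ≤ (fib X i).card → 2 ≤ (fib Y i).card → 2 * T.card ≤ z i + 6 := by
    intro i hi hi'
    have := F2 (by omega) hH hX hY h i hi hi'
    rw [hNs] at this
    have := hz i
    omega
  have h4c : Fintype.card W - 1 ≤ c := by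
    have h3 : Fintype.card W * (Fintype.card W - 1) ≤ Fintype.card W * c := by
      rw [mul_comm _ c]; omega
    exact Nat.le_of_mul_le_mul_left h3 (by omega)
  have h5c : Fintype.card W * (Fintype.card W - 1) ≤ 4 * c := by
    have e1 : 2 * c * Fintype.card W = (Fintype.card W - 1).factorial * Fintype.card W := by
      rw [mul_comm _ (Fintype.card W), mul_comm _ (Fintype.card W),
        Nat.mul_factorial_pred (by omega), ← hN, hNc]
      ring
    have e2 := Nat.eq_of_mul_eq_mul_right (by omega) e1
    obtain ⟨v, hv⟩ := Nat.exists_eq_add_of_le hW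
    rw [hv, show 4 + v - 1 = (2 + v) + 1 by omega, Nat.factorial_succ,
      show 2 + v = (1 + v) + 1 by omega, Nat.factorial_succ] at e2
    rw [hv, show 4 + v - 1 = 3 + v by omega]
    have e3 : 1 ≤ (1 + v).factorial := Nat.factorial_pos _
    have e4 := Nat.mul_le_mul_left ((1 + v + 1 + 1) * (1 + v + 1)) e3
    rw [mul_assoc (1 + v + 1 + 1)] at e4
    nlinarith
  have key := num_core (fun i => (fib X i).card) (fun i => (fib Y i).card) z N T.card D.card
    (D.card * c) hz (fun i hi hi' => by
      have e1 := hx1 i hi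
      have e2 := hy1 i hi'
      have e3 := hz i
      have e4 := hb i
      by_cases q1 : 2 ≤ (fib X i).card
      · by_cases q2 : 2 ≤ (fib Y i).card
        · have := e4 q1 q2; omega
        · omega
      · omega) hb hc
    (fun i j => by simp only [hsc]; exact F4b hX hY hs i j)
    (fun i => by simp only [hsc]; exact F4a hX hY hs i)
    (fun i j => by simp only [hsc']; exact F4b hY hYn h i j)
    (fun i => by simp only [hsc']; exact F4a hY hYn h i)
    (by rw [← card_eq_sum_fib]; omega) (by rw [← card_eq_sum_fib]; omega)
    (by rw [Fintype.card_option]; omega) hD hm5 hDT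
    (by
      obtain ⟨d, hd⟩ := Nat.exists_eq_add_of_le hD
      obtain ⟨b, hb⟩ := Nat.exists_eq_add_of_le (show 2 ≤ c by omega)
      rw [hd, hb]; rw [hb] at h5c
      nlinarith [Nat.zero_le (d * b)]) (by omega)
  rw [card_ext, Fintype.card_option, Nat.factorial_succ, ← hN]
  have : (Fintype.card W + 1) * (2 * N) = 2 * ((Fintype.card W + 1) * N) := by ring
  omega

theorem step_weak (hW : Fintype.card W = 3) (hT : ∀ t ∈ T, t.IsSwap)
    (hD : 2 ≤ D.card) (hm : T.card = 3) : Hole (ext T D) 12 := by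
  intro s X Y hX hY h h1 h2
  have hE := ext_isSwap (D := D) hT
  have hs := h.symm hE
  have hYn : ∀ x ∈ X, Perm.sign x = - -s := by simpa using hX
  obtain ⟨N, c, z, hN, hNc, hNs, hz, hc, hyz, hxz, hx1, hy1, htot⟩ :=
    pre_step (by omega) hT (card_pos.1 (by omega)) hX hY h
  have hsc : ∀ k, (fib Y k).card + z k = (fib (sgn W s \ X) k).card := fun k => (hyz k).symm
  have hsc' : ∀ k, (fib X k).card + z k = (fib (sgn W (-s) \ Y) k).card := fun k => (hxz k).symm
  rw [hW] at hN hNc htot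
  have hN3 : N = 3 := by simp [Nat.factorial] at hN; omega
  have hc1 : c = 1 := by omega
  have key := num_nomix (fun i => (fib X i).card) (fun i => (fib Y i).card) z N D.card
    (D.card * c) (2 * D.card) hz (fun i => by
      have e1 := hx1 i
      have e2 := hy1 i
      omega) hc
    (fun i => by simp only [hsc]; exact F4a hX hY hs i)
    (fun i => by simp only [hsc']; exact F4a hY hYn h i)
    (by rw [← card_eq_sum_fib]; omega) (by rw [← card_eq_sum_fib]; omega) hD
    (by rw [hc1]; omega) (by omega)
  rw [card_ext, Fintype.card_option, hW]
  simp [Nat.factorial]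
  omega
end steps
section seq

theorem Hole.transport {V V' : Type*} [Fintype V] [DecidableEq V] [Fintype V'] [DecidableEq V']
    (φ : V ≃ V') {T : Finset (Perm V)} {T' : Finset (Perm V')} {c : ℕ}
    (hTT : T' = T.image φ.permCongr) (h : Hole T c) : Hole T' c := by
  intro s X Y hX hY hN h1 h2
  have := h s (X.map φ.permCongr.symm.toEmbedding) (Y.map φ.permCongr.symm.toEmbedding)
    (by
      intro x hx
      rw [mem_map_equiv, symm_symm] at hx
      rw [← hX _ hx, Perm.sign_permCongr])
    (by
      intro x hx
      rw [mem_map_equiv, symm_symm] at hx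
      rw [← hY _ hx, Perm.sign_permCongr])
    (by
      intro x hx t ht hxt
      rw [mem_map_equiv, symm_symm] at hx hxt
      refine hN _ hx (φ.permCongr t) (by rw [hTT]; exact mem_image_of_mem _ ht) ?_
      rwa [permCongr_mul] at hxt)
    (by rwa [card_map]) (by rwa [card_map])
  rw [card_map, card_map] at this
  rw [hTT, card_image_of_injective _ φ.permCongr.injective, ← Fintype.card_congr φ]
  exact this

theorem permCongr_swap' {V V' : Type*} [DecidableEq V] [DecidableEq V']
    (φ : V ≃ V') (a b : V) : φ.permCongr (swap a b) = swap (φ a) (φ b) := by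
  ext x
  simp [permCongr_apply, swap_apply_def, symm_apply_eq]
  split_ifs <;> simp

open Classical in
noncomputable def TS (G : SimpleGraph ℕ) (j : ℕ) : Finset (Perm (Fin j)) :=
  univ.filter (fun t => ∃ a b : Fin j, G.Adj a b ∧ t = swap a b)

open Classical in
noncomputable def DS (G : SimpleGraph ℕ) (j : ℕ) : Finset (Fin j) :=
  univ.filter (fun a => G.Adj j a)

theorem mem_TS {G : SimpleGraph ℕ} {j : ℕ} {t : Perm (Fin j)} :
    t ∈ TS G j ↔ ∃ a b : Fin j, G.Adj a b ∧ t = swap a b := by simp [TS]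

theorem mem_DS {G : SimpleGraph ℕ} {j : ℕ} {a : Fin j} : a ∈ DS G j ↔ G.Adj j a := by simp [DS]

theorem TS_isSwap (G : SimpleGraph ℕ) (j : ℕ) : ∀ t ∈ TS G j, t.IsSwap := by
  intro t ht
  obtain ⟨a, b, hab, rfl⟩ := mem_TS.1 ht
  exact ⟨a, b, fun h => G.loopless.irrefl _ (h ▸ hab), rfl⟩

theorem TS_succ (G : SimpleGraph ℕ) (j : ℕ) :
    TS G (j + 1) = (ext (TS G j) (DS G j)).image finSuccEquivLast.symm.permCongr := by
  ext t
  constructor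
  · intro ht
    obtain ⟨a, b, hab, rfl⟩ := mem_TS.1 ht
    rw [mem_image]
    induction a using Fin.lastCases with
    | last =>
      induction b using Fin.lastCases with
      | last => exact absurd hab (G.loopless.irrefl _)
      | cast b =>
        refine ⟨_, sw_mem_ext (w := b) (mem_DS.2 (by simpa using hab)), ?_⟩
        rw [permCongr_swap']; simp
    | cast a =>
      induction b using Fin.lastCases with
      | last =>
        refine ⟨_, sw_mem_ext (w := a) (mem_DS.2 (by simpa using hab.symm)), ?_⟩
        rw [permCongr_swap', swap_comm]; simp
      | cast b =>
        refine ⟨_, oc_mem_ext (mem_TS.2 ⟨a, b, by simpa using hab, rfl⟩), ?_⟩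
        rw [optionCongr_swap, permCongr_swap']; simp
  · intro ht
    obtain ⟨u, hu, rfl⟩ := mem_image.1 ht
    rw [mem_TS]
    rw [ext, mem_union] at hu
    rcases hu with hu | hu
    · obtain ⟨t, ht2, rfl⟩ := mem_image.1 hu
      obtain ⟨a, b, hab, rfl⟩ := mem_TS.1 ht2
      refine ⟨a.castSucc, b.castSucc, by simpa using hab, ?_⟩
      rw [optionCongr_swap, permCongr_swap']; simp
    · obtain ⟨a, ha, rfl⟩ := mem_image.1 hu
      refine ⟨Fin.last j, a.castSucc, by simpa using mem_DS.1 ha, ?_⟩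
      rw [permCongr_swap']; simp

theorem card_TS_succ (G : SimpleGraph ℕ) (j : ℕ) :
    (TS G (j + 1)).card = (TS G j).card + (DS G j).card := by
  rw [TS_succ, card_image_of_injective _ (Equiv.injective _), card_ext]

theorem TS_zero (G : SimpleGraph ℕ) : (TS G 0).card = 0 := by
  rw [card_eq_zero, eq_empty_iff_forall_notMem]
  intro t ht
  obtain ⟨a, -⟩ := mem_TS.1 ht
  exact a.elim0

variable {G : SimpleGraph ℕ} {N k : ℕ}

theorem TS_small (hD : ∀ i < N, (DS G i).card = min i k) (hk : 2 ≤ k) (hN : 3 ≤ N) :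
    (TS G 3).card = 3 := by
  have h0 := TS_zero G
  have h1 := card_TS_succ G 0
  have h2 := card_TS_succ G 1
  have h3 := card_TS_succ G 2
  rw [hD 0 (by omega)] at h1
  rw [hD 1 (by omega)] at h2
  rw [hD 2 (by omega)] at h3
  simp only [Nat.reduceAdd] at h1 h2 h3
  omega

theorem TS_ge (hD : ∀ i < N, (DS G i).card = min i k) (hk : 2 ≤ k) (j : ℕ) (hj : 3 ≤ j)
    (hjN : j ≤ N) : 2 * j ≤ (TS G j).card + 3 := by
  induction j, hj using Nat.le_induction with
  | base => rw [TS_small hD hk hjN]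
  | succ j hj ih =>
    have := ih (by omega)
    rw [card_TS_succ, hD j (by omega)]
    omega

theorem TS_le (hD : ∀ i < N, (DS G i).card = min i k) (j : ℕ)
    (hjN : j ≤ N) : 2 * (TS G j).card ≤ j * (j - 1) := by
  induction j with
  | zero => rw [TS_zero]
  | succ j ih =>
    have := ih (by omega)
    rw [card_TS_succ, hD j (by omega)]
    rcases j with _ | j
    · simp at *; omega
    · simp only [Nat.add_sub_cancel] at *
      have : min (j + 1) k ≤ j + 1 := min_le_left _ _
      nlinarith

theorem TS_eq1 (hD : ∀ i < N, (DS G i).card = min i k) (j : ℕ) (hjk : j ≤ k + 1)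
    (hjN : j ≤ N) : 2 * (TS G j).card + j = j * j := by
  induction j with
  | zero => rw [TS_zero]
  | succ j ih =>
    have := ih (by omega) (by omega)
    rw [card_TS_succ, hD j (by omega), min_eq_left (by omega)]
    nlinarith

theorem TS_eq2 (hD : ∀ i < N, (DS G i).card = min i k) (j : ℕ) (hjk : k + 1 ≤ j)
    (hjN : j ≤ N) : 2 * (TS G j).card + k * (k + 1) = 2 * (k * j) := by
  induction j, hjk using Nat.le_induction with
  | base =>
    have := TS_eq1 hD (k + 1) le_rfl hjN
    nlinarith
  | succ j hj ih =>
    have := ih (by omega)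
    rw [card_TS_succ, hD j (by omega), min_eq_right (by omega)]
    nlinarith

theorem hole_weak (hD : ∀ i < N, (DS G i).card = min i k) (hk : 2 ≤ k) (j : ℕ) (hj : 4 ≤ j)
    (hjN : j ≤ N) : Hole (TS G j) 12 ∧ (5 ≤ j → Hole (TS G j) 10) := by
  induction j, hj using Nat.le_induction with
  | base =>
    refine ⟨?_, by omega⟩
    exact Hole.transport _ (TS_succ G 3) (step_weak (by simp) (TS_isSwap G 3)
      (by rw [hD 3 (by omega)]; omega) (TS_small hD hk (by omega)))
  | succ j hj ih =>
    have h12 := (ih (by omega)).1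
    have hs : Hole (TS G (j + 1)) 10 := by
      have hge := TS_ge hD hk j (by omega) (by omega)
      refine Hole.transport _ (TS_succ G j) (step_strong (by simpa using hj) (TS_isSwap G j) h12
        (by rw [hD j (by omega)]; omega) (by omega) ?_
        (by simpa using TS_le hD j (by omega)))
      obtain ⟨l, rfl⟩ : ∃ l, j = l + 1 := ⟨j - 1, by omega⟩
      have hge := TS_ge hD hk l (by omega) (by omega)
      rw [card_TS_succ, hD l (by omega), hD (l + 1) (by omega)]
      omega
    exact ⟨hs.mono (by omega), fun _ => hs⟩

end seq
section lower
variable {n : ℕ} {T : Set (Perm (Fin n))} {Tf : Finset (Perm (Fin n))}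

theorem isSwap_inv {t : Perm (Fin n)} (h : t.IsSwap) : t⁻¹ = t := by
  obtain ⟨a, b, -, rfl⟩ := h; exact swap_inv a b

theorem cayley_adj (hT : ∀ t ∈ T, t.IsSwap) (g h : Perm (Fin n)) :
    (cayley T).Adj g h ↔ g⁻¹ * h ∈ T := by
  unfold cayley
  rw [SimpleGraph.fromRel_adj]
  constructor
  · rintro ⟨-, ⟨t, ht, rfl⟩ | ⟨t, ht, rfl⟩⟩
    · simpa using ht
    · have := isSwap_inv (hT t ht)
      rw [mul_inv_rev, this]; simpa using ht
  · intro ht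
    refine ⟨?_, Or.inl ⟨_, ht, by simp⟩⟩
    rintro rfl
    have := sign_isSwap (hT _ ht)
    simp at this

theorem cayley_sign (hT : ∀ t ∈ T, t.IsSwap) {g h : Perm (Fin n)} (hgh : (cayley T).Adj g h) :
    Perm.sign h = - Perm.sign g := by
  have h1 := sign_isSwap (hT _ ((cayley_adj hT g h).1 hgh))
  rw [Perm.sign_mul, Perm.sign_inv] at h1
  have : Perm.sign g * (Perm.sign g * Perm.sign h) = Perm.sign g * -1 := by rw [h1]
  rw [← mul_assoc, Int.units_mul_self, one_mul] at this
  simpa using this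

theorem two_each (hT : ∀ t ∈ T, t.IsSwap) {F : Set (Perm (Fin n))}
    (hdeg : ∀ v, v ∉ F → 2 ≤ {u | u ∉ F ∧ (cayley T).Adj v u}.ncard)
    (S : Finset (Perm (Fin n))) (hS : ∀ g ∈ S, g ∉ F) (hne : S.Nonempty)
    (hcl : ∀ g ∈ S, ∀ h, h ∉ F → (cayley T).Adj g h → h ∈ S) (s : ℤˣ) :
    2 ≤ (S.filter (fun g => Perm.sign g = s)).card := by
  have key : ∀ g ∈ S, 2 ≤ (S.filter (fun h => Perm.sign h = - Perm.sign g)).card := by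
    intro g hg
    refine le_trans (hdeg g (hS g hg)) ?_
    rw [← Set.ncard_coe_finset]
    apply Set.ncard_le_ncard _ (Finset.finite_toSet _)
    intro h hh
    rw [Finset.mem_coe, mem_filter]
    exact ⟨hcl g hg h hh.1 hh.2, cayley_sign hT hh.2⟩
  obtain ⟨g, hg⟩ := hne
  have h1 := key g hg
  obtain ⟨h, hh⟩ := card_pos.1 (lt_of_lt_of_le two_pos h1)
  rw [mem_filter] at hh
  have h2 := key h hh.1
  rw [hh.2, neg_neg] at h2
  rcases Int.units_eq_one_or s with rfl | rfl <;>
    rcases Int.units_eq_one_or (Perm.sign g) with h' | h' <;> rw [h'] at h1 h2 <;> simpa using ‹_›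

theorem card_sign_split (S : Finset (Perm (Fin n))) :
    (S.filter (fun g => Perm.sign g = 1)).card + (S.filter (fun g => Perm.sign g = -1)).card
      = S.card := by
  rw [← card_filter_add_card_filter_not (s := S) (fun g => Perm.sign g = 1)]
  congr 2
  apply filter_congr
  intro g _
  exact Int.units_ne_iff_eq_neg.symm

theorem lower (hTf : ∀ t, t ∈ Tf ↔ t ∈ T) (hT : ∀ t ∈ T, t.IsSwap) (hH : Hole Tf 10)
    (hmn : 4 * Tf.card ≤ n.factorial + 10) {F : Set (Perm (Fin n))}
    (hF : IsRkCut (cayley T) 2 F) : 4 * Tf.card ≤ F.ncard + 10 := by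
  classical
  obtain ⟨hconn, hdeg⟩ := hF
  have hcard : ∀ S : Finset (Perm (Fin n)), S.card ≤ n.factorial := by
    intro S
    have := card_le_univ S
    rwa [Fintype.card_perm, Fintype.card_fin] at this
  by_cases hne : Nonempty (Fᶜ : Set (Perm (Fin n)))
  swap
  · have : F = Set.univ := by
      ext g
      simp only [Set.mem_univ, iff_true]
      by_contra hg
      exact hne ⟨⟨g, hg⟩⟩
    rw [this, Set.ncard_univ, Nat.card_eq_fintype_card, Fintype.card_perm, Fintype.card_fin]
    exact hmn
  have : ¬ ((cayley T).induce (Fᶜ : Set _)).Preconnected := fun h =>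
    hconn ((SimpleGraph.connected_iff _).2 ⟨h, hne⟩)
  unfold SimpleGraph.Preconnected at this
  push Not at this
  obtain ⟨u, v, huv⟩ := this
  set A : Finset (Perm (Fin n)) := univ.filter (fun g => ∃ h : g ∈ (Fᶜ : Set _),
    ((cayley T).induce (Fᶜ : Set _)).Reachable u ⟨g, h⟩) with hA
  set B : Finset (Perm (Fin n)) := univ.filter (fun g => g ∉ F ∧ g ∉ A) with hB
  have mA : ∀ g, g ∈ A ↔ ∃ h : g ∈ (Fᶜ : Set _),
    ((cayley T).induce (Fᶜ : Set _)).Reachable u ⟨g, h⟩ := by intro g; simp [hA]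
  have mB : ∀ g, g ∈ B ↔ g ∉ F ∧ g ∉ A := by intro g; simp [hB]
  have clA : ∀ g ∈ A, ∀ h, h ∉ F → (cayley T).Adj g h → h ∈ A := by
    intro g hg h hh hgh
    obtain ⟨h1, h2⟩ := (mA g).1 hg
    refine (mA h).2 ⟨hh, h2.trans ?_⟩
    apply SimpleGraph.Adj.reachable
    exact hgh
  have clB : ∀ g ∈ B, ∀ h, h ∉ F → (cayley T).Adj g h → h ∈ B := by
    intro g hg h hh hgh
    rw [mB] at hg ⊢
    exact ⟨hh, fun hA => hg.2 (clA h hA g hg.1 hgh.symm)⟩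
  have eA := two_each hT hdeg A (fun g hg => ((mA g).1 hg).1)
    ⟨u, (mA _).2 ⟨u.2, SimpleGraph.Reachable.refl _⟩⟩ clA
  have eB := two_each hT hdeg B (fun g hg => ((mB g).1 hg).1)
    ⟨v, (mB _).2 ⟨v.2, fun h => huv ((mA _).1 h).2⟩⟩ clB
  have hNo : ∀ s s' : ℤˣ, NoE Tf (A.filter (fun g => Perm.sign g = s))
      (B.filter (fun g => Perm.sign g = s')) := by
    intro s s' x hx t ht hxt
    rw [mem_filter] at hx hxt
    have hb := (mB _).1 hxt.1
    refine hb.2 (clA x hx.1 _ hb.1 ((cayley_adj hT _ _).2 ?_))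
    rw [inv_mul_cancel_left]
    exact (hTf t).1 ht
  have r1 := hH 1 _ _ (fun x hx => (mem_filter.1 hx).2) (fun x hx => (mem_filter.1 hx).2)
    (hNo 1 (-1)) (eA 1) (eB (-1))
  have r2 := hH (-1) _ _ (fun x hx => (mem_filter.1 hx).2)
    (fun x hx => by rw [neg_neg]; exact (mem_filter.1 hx).2)
    (hNo (-1) 1) (eA (-1)) (eB 1)
  have sA := card_sign_split A
  have sB := card_sign_split B
  have htot : n.factorial ≤ A.card + B.card + F.ncard := by
    have h1 : (univ : Finset (Perm (Fin n))) ⊆ A ∪ B ∪ F.toFinset := by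
      intro g _
      rw [mem_union, mem_union, Set.mem_toFinset, mB]
      tauto
    have h2 := card_le_card h1
    rw [card_univ, Fintype.card_perm, Fintype.card_fin] at h2
    have h3 := card_union_le (A ∪ B) F.toFinset
    have h4 := card_union_le A B
    rw [Set.ncard_eq_toFinset_card']
    omega
  rw [Fintype.card_fin] at r1 r2
  omega

end lower
section upper
variable {n : ℕ} {T : Set (Perm (Fin n))} {Tf : Finset (Perm (Fin n))}

theorem nb_sign (hT : ∀ t ∈ Tf, t.IsSwap) {g h : Perm (Fin n)} (hgh : h ∈ nb Tf g) :
    Perm.sign h = - Perm.sign g := by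
  refine cayley_sign (T := (Tf : Set _)) (fun t ht => hT t ht) ?_
  rw [cayley_adj (fun t ht => hT t ht)]
  exact mem_nb.1 hgh

theorem walk_closed {V : Type*} {H : SimpleGraph V} (P : V → Prop)
    (hP : ∀ x y, P x → H.Adj x y → P y) {x y : V} (w : H.Walk x y) (hx : P x) : P y := by
  induction w with
  | nil => exact hx
  | cons h _ ih => exact ih (hP _ _ hx h)

set_option maxHeartbeats 2000000 in
theorem upper (hTf : ∀ t, t ∈ Tf ↔ t ∈ T) (hT : ∀ t ∈ T, t.IsSwap) {a b c : Fin n}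
    (hab : a ≠ b) (hbc : b ≠ c) (hac : a ≠ c) (hp : swap a b ∈ Tf) (hq : swap b c ∈ Tf)
    (hr : swap a c ∈ Tf) (hm7 : 7 ≤ Tf.card) (hmn : 4 * Tf.card < n.factorial + 6) :
    ∃ F : Set (Perm (Fin n)), IsRkCut (cayley T) 2 F ∧ F.ncard + 10 ≤ 4 * Tf.card := by
  classical
  have hTs : ∀ t ∈ Tf, t.IsSwap := fun t ht => hT t ((hTf t).1 ht)
  set p := swap a b with hpd
  set q := swap b c with hqd
  set r := swap a c with hrd
  have pa : p a = b := swap_apply_left _ _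
  have pb : p b = a := swap_apply_right _ _
  have pc : p c = c := swap_apply_of_ne_of_ne hac.symm hbc.symm
  have qa : q a = a := swap_apply_of_ne_of_ne hab hac
  have qb : q b = c := swap_apply_left _ _
  have qc : q c = b := swap_apply_right _ _
  have ra : r a = c := swap_apply_left _ _
  have rb : r b = b := swap_apply_of_ne_of_ne hab.symm hbc
  have rc : r c = a := swap_apply_right _ _
  have pp : p * p = 1 := swap_mul_self _ _
  have qq : q * q = 1 := swap_mul_self _ _
  have rr : r * r = 1 := swap_mul_self _ _
  have pi : p⁻¹ = p := swap_inv _ _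
  have qi : q⁻¹ = q := swap_inv _ _
  have ri : r⁻¹ = r := swap_inv _ _
  have off : ∀ x, x ≠ a → x ≠ b → x ≠ c → p x = x ∧ q x = x ∧ r x = x := fun x h1 h2 h3 =>
    ⟨swap_apply_of_ne_of_ne h1 h2, swap_apply_of_ne_of_ne h2 h3, swap_apply_of_ne_of_ne h1 h3⟩
  have pqr : p * q = q * r := by
    ext x : 1
    by_cases h1 : x = a
    · simp [h1, pa, pb, pc, qa, qb, qc, ra, rb, rc]
    by_cases h2 : x = b
    · simp [h2, pa, pb, pc, qa, qb, qc, ra, rb, rc]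
    by_cases h3 : x = c
    · simp [h3, pa, pb, pc, qa, qb, qc, ra, rb, rc]
    simp [off x h1 h2 h3]
  have prp : p * q = r * p := by
    ext x : 1
    by_cases h1 : x = a
    · simp [h1, pa, pb, pc, qa, qb, qc, ra, rb, rc]
    by_cases h2 : x = b
    · simp [h2, pa, pb, pc, qa, qb, qc, ra, rb, rc]
    by_cases h3 : x = c
    · simp [h3, pa, pb, pc, qa, qb, qc, ra, rb, rc]
    simp [off x h1 h2 h3]
  have npq : p ≠ q := fun h => hab (by rw [← qa, ← h, pa])
  have npr : p ≠ r := fun h => hbc (by rw [← pa, h, ra])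
  have nqr : q ≠ r := fun h => hac (by rw [← ra, ← h, qa])
  have n1 : (1 : Perm (Fin n)) ≠ p * q := fun h => hab (by
    have := congrArg (fun g : Perm (Fin n) => g a) h
    simpa [qa, pa] using this)
  have n2 : (1 : Perm (Fin n)) ≠ q * p := fun h => hac (by
    have := congrArg (fun g : Perm (Fin n) => g a) h
    simpa [qa, pa, qb] using this)
  have n3 : p * q ≠ q * p := fun h => hbc (by
    have := congrArg (fun g : Perm (Fin n) => g a) h
    simpa [qa, pa, qb] using this)
  have sp : Perm.sign p = -1 := sign_isSwap (hTs _ hp)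
  have sq : Perm.sign q = -1 := sign_isSwap (hTs _ hq)
  have spq : Perm.sign (p * q) = 1 := by rw [Perm.sign_mul, sp, sq]; rfl
  have a1p : p ∈ nb Tf 1 := mem_nb.2 (by simpa using hp)
  have a1q : q ∈ nb Tf 1 := mem_nb.2 (by simpa using hq)
  have a1r : r ∈ nb Tf 1 := mem_nb.2 (by simpa using hr)
  have arp : p ∈ nb Tf (p * q) := mem_nb.2 (by
    rw [mul_inv_rev, pi, qi, mul_assoc, pp, mul_one]; exact hq)
  have arq : q ∈ nb Tf (p * q) := mem_nb.2 (by
    rw [pqr, mul_inv_rev, ri, qi, mul_assoc, qq, mul_one]; exact hr)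
  have arr : r ∈ nb Tf (p * q) := mem_nb.2 (by
    rw [prp, mul_inv_rev, ri, pi, mul_assoc, rr, mul_one]; exact hp)
  have ap1 : 1 ∈ nb Tf p := mem_nb.2 (by rw [pi, mul_one]; exact hp)
  have aq1 : 1 ∈ nb Tf q := mem_nb.2 (by rw [qi, mul_one]; exact hq)
  have apr : p * q ∈ nb Tf p := mem_nb.2 (by simpa using hq)
  have aqr : p * q ∈ nb Tf q := mem_nb.2 (by rw [pqr]; simpa using hr)
  have aqs : q * p ∈ nb Tf q := mem_nb.2 (by simpa using hp)
  have aps : q * p ∈ nb Tf p := mem_nb.2 (by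
    rw [pi, ← mul_assoc, prp, mul_assoc, pp, mul_one]; exact hr)
  have c1 := card_union_add_card_inter (nb Tf 1) (nb Tf (p * q))
  have c2 := card_union_add_card_inter (nb Tf p) (nb Tf q)
  rw [card_nb, card_nb] at c1 c2
  have c3 : 3 ≤ (nb Tf 1 ∩ nb Tf (p * q)).card := by
    rw [← card_eq_three.2 ⟨p, q, r, npq, npr, nqr, rfl⟩]
    apply card_le_card
    intro x hx
    simp only [mem_insert, mem_singleton] at hx
    rw [mem_inter]
    rcases hx with rfl | rfl | rfl
    exacts [⟨a1p, arp⟩, ⟨a1q, arq⟩, ⟨a1r, arr⟩]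
  have c4 : 3 ≤ (nb Tf p ∩ nb Tf q).card := by
    rw [← card_eq_three.2 ⟨1, p * q, q * p, n1, n2, n3, rfl⟩]
    apply card_le_card
    intro x hx
    simp only [mem_insert, mem_singleton] at hx
    rw [mem_inter]
    rcases hx with rfl | rfl | rfl
    exacts [⟨ap1, aq1⟩, ⟨apr, aqr⟩, ⟨aps, aqs⟩]
  set O := (nb Tf 1 ∪ nb Tf (p * q)) \ {p, q} with hO
  set E := (nb Tf p ∪ nb Tf q) \ {1, p * q} with hE
  have cO : O.card + 2 = (nb Tf 1 ∪ nb Tf (p * q)).card := by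
    rw [← card_pair npq, hO]
    apply card_sdiff_add_card_eq_card
    intro x hx
    simp only [mem_insert, mem_singleton] at hx
    rcases hx with rfl | rfl
    exacts [mem_union_left _ a1p, mem_union_left _ a1q]
  have cE : E.card + 2 = (nb Tf p ∪ nb Tf q).card := by
    rw [← card_pair n1, hE]
    apply card_sdiff_add_card_eq_card
    intro x hx
    simp only [mem_insert, mem_singleton] at hx
    rcases hx with rfl | rfl
    exacts [mem_union_left _ ap1, mem_union_left _ apr]
  have sO' : ∀ x ∈ nb Tf 1 ∪ nb Tf (p * q), Perm.sign x = -1 := by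
    intro x hx
    rcases mem_union.1 hx with h | h
    · rw [nb_sign hTs h, Perm.sign_one]
    · rw [nb_sign hTs h, spq]
  have sE' : ∀ x ∈ nb Tf p ∪ nb Tf q, Perm.sign x = 1 := by
    intro x hx
    rcases mem_union.1 hx with h | h
    · rw [nb_sign hTs h, sp, neg_neg]
    · rw [nb_sign hTs h, sq, neg_neg]
  have sO : ∀ x ∈ O, Perm.sign x = -1 := fun x hx => sO' x (mem_sdiff.1 hx).1
  have sE : ∀ x ∈ E, Perm.sign x = 1 := fun x hx => sE' x (mem_sdiff.1 hx).1
  have h11 : (1 : ℤˣ) ≠ -1 := by decide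
  set A : Finset (Perm (Fin n)) := {1, p * q, p, q} with hA
  have mA : ∀ x, x ∈ A ↔ x = 1 ∨ x = p * q ∨ x = p ∨ x = q := by intro x; simp [hA]
  set F := O ∪ E with hF
  have disj : ∀ x ∈ A, x ∉ F := by
    intro x hx hxF
    rw [hF, mem_union] at hxF
    rcases (mA x).1 hx with rfl | rfl | rfl | rfl
    · rcases hxF with h | h
      · exact h11 ((Perm.sign_one (α := Fin n)).symm.trans (sO _ h))
      · rw [hE] at h; simp at h
    · rcases hxF with h | h
      · exact h11 (spq.symm.trans (sO _ h))
      · rw [hE] at h; simp at h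
    · rcases hxF with h | h
      · rw [hO] at h; simp at h
      · exact h11 ((sE _ h).symm.trans sp)
    · rcases hxF with h | h
      · rw [hO] at h; simp at h
      · exact h11 ((sE _ h).symm.trans sq)
  have adj_nb : ∀ g h, (cayley T).Adj g h ↔ h ∈ nb Tf g := by
    intro g h
    rw [cayley_adj hT, mem_nb, hTf]
  have closed : ∀ x ∈ A, ∀ y, y ∉ F → (cayley T).Adj x y → y ∈ A := by
    intro x hx y hy hxy
    rw [adj_nb] at hxy
    rw [hF, mem_union, not_or] at hy
    rw [mA]
    rw [hO, hE, mem_sdiff, mem_sdiff] at hy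
    simp only [mem_union, mem_insert, mem_singleton] at hy
    obtain ⟨y1, y2⟩ := hy
    rcases (mA x).1 hx with hx | hx | hx | hx
    · rw [hx] at hxy
      have : y = p ∨ y = q := by by_contra h; exact y1 ⟨Or.inl hxy, h⟩
      exact Or.inr (Or.inr this)
    · rw [hx] at hxy
      have : y = p ∨ y = q := by by_contra h; exact y1 ⟨Or.inr hxy, h⟩
      exact Or.inr (Or.inr this)
    · rw [hx] at hxy
      have : y = 1 ∨ y = p * q := by by_contra h; exact y2 ⟨Or.inl hxy, h⟩
      exact this.elim Or.inl (fun h => Or.inr (Or.inl h))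
    · rw [hx] at hxy
      have : y = 1 ∨ y = p * q := by by_contra h; exact y2 ⟨Or.inr hxy, h⟩
      exact this.elim Or.inl (fun h => Or.inr (Or.inl h))
  have cF : F.card + 10 ≤ 4 * Tf.card := by
    have h0 : F.card ≤ O.card + E.card := card_union_le O E
    omega
  have cA : A.card ≤ 4 := card_le_four
  obtain ⟨v, hv⟩ : ∃ v, v ∉ A ∪ F := by
    by_contra! h
    have h1 : (A ∪ F) = univ := eq_univ_iff_forall.2 h
    have h2 := card_union_le A F
    rw [h1, card_univ, Fintype.card_perm, Fintype.card_fin] at h2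
    omega
  rw [mem_union, not_or] at hv
  refine ⟨(F : Set _), ⟨?_, ?_⟩, by rw [Set.ncard_coe_finset]; exact cF⟩
  · intro hconn
    have m1 : (1 : Perm (Fin n)) ∈ A := (mA _).2 (Or.inl rfl)
    obtain ⟨w⟩ := hconn.preconnected ⟨1, fun h => disj 1 m1 h⟩ ⟨v, fun h => hv.2 h⟩
    exact hv.1 (walk_closed (fun x => x.1 ∈ A) (fun x y hx hxy => closed x.1 hx y.1
      (fun h => y.2 h) hxy) w m1)
  · intro v hvF
    have hvF : v ∉ F := fun h => hvF h
    have e : {u : Perm (Fin n) | u ∉ (F : Set _) ∧ (cayley T).Adj v u} =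
        ((nb Tf v \ F : Finset _) : Set _) := by
      ext u
      simp [adj_nb, and_comm]
    rw [e, Set.ncard_coe_finset]
    have pF := disj p ((mA _).2 (Or.inr (Or.inr (Or.inl rfl))))
    have qF := disj q ((mA _).2 (Or.inr (Or.inr (Or.inr rfl))))
    have oF := disj 1 ((mA _).2 (Or.inl rfl))
    have rF := disj (p * q) ((mA _).2 (Or.inr (Or.inl rfl)))
    by_cases hvA : v ∈ A
    · rcases (mA v).1 hvA with rfl | rfl | rfl | rfl
      · rw [← card_pair npq]
        apply card_le_card
        intro x hx
        simp only [mem_insert, mem_singleton] at hx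
        rcases hx with rfl | rfl
        exacts [mem_sdiff.2 ⟨a1p, pF⟩, mem_sdiff.2 ⟨a1q, qF⟩]
      · rw [← card_pair npq]
        apply card_le_card
        intro x hx
        simp only [mem_insert, mem_singleton] at hx
        rcases hx with rfl | rfl
        exacts [mem_sdiff.2 ⟨arp, pF⟩, mem_sdiff.2 ⟨arq, qF⟩]
      · rw [← card_pair n1]
        apply card_le_card
        intro x hx
        simp only [mem_insert, mem_singleton] at hx
        rcases hx with rfl | rfl
        exacts [mem_sdiff.2 ⟨ap1, oF⟩, mem_sdiff.2 ⟨apr, rF⟩]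
      · rw [← card_pair n1]
        apply card_le_card
        intro x hx
        simp only [mem_insert, mem_singleton] at hx
        rcases hx with rfl | rfl
        exacts [mem_sdiff.2 ⟨aq1, oF⟩, mem_sdiff.2 ⟨aqr, rF⟩]
    · have hsupp : (p * q).support.card ≤ 3 := by
        refine le_trans (card_le_card (t := {a, b, c}) ?_) card_le_three
        intro x hx
        simp only [mem_insert, mem_singleton]
        by_contra! h
        have := off x h.1 h.2.1 h.2.2
        rw [Perm.mem_support, Perm.mul_apply, this.2.1, this.1] at hx
        exact hx rfl
      have h5 : (nb Tf v ∩ F).card ≤ 5 := by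
        rw [mA, not_or, not_or, not_or] at hvA
        rcases Int.units_eq_one_or (Perm.sign v) with hs | hs
        · refine le_trans (card_le_card ?_) (five hTs (u₁ := 1) (u₂ := p * q) (v := v)
            (Ne.symm hvA.1) (Ne.symm hvA.2.1) (by simpa using hsupp))
          intro x hx
          rw [mem_inter] at hx ⊢
          refine ⟨hx.1, ?_⟩
          have hsx := nb_sign hTs hx.1
          rw [hs] at hsx
          rcases mem_union.1 hx.2 with h | h
          · exact (mem_sdiff.1 h).1
          · exact absurd ((sE x h).symm.trans hsx) h11
        · refine le_trans (card_le_card ?_) (five hTs (u₁ := p) (u₂ := q) (v := v)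
            (Ne.symm hvA.2.2.1) (Ne.symm hvA.2.2.2) (by rw [pi]; exact hsupp))
          intro x hx
          rw [mem_inter] at hx ⊢
          refine ⟨hx.1, ?_⟩
          have hsx := nb_sign hTs hx.1
          rw [hs, neg_neg] at hsx
          rcases mem_union.1 hx.2 with h | h
          · exact absurd (hsx.symm.trans (sO x h)) h11
          · exact (mem_sdiff.1 h).1
      have h6 := card_sdiff_add_card_inter (nb Tf v) F
      rw [card_nb] at h6
      omega

end upper
section final
variable {n k : ℕ} {T : Set (Perm (Fin n))}

theorem tg_adj (a b : Fin n) : (transGraph T).Adj a b ↔ a ≠ b ∧ swap a b ∈ T := by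
  unfold transGraph
  rw [SimpleGraph.fromRel_adj, swap_comm b a, or_self]

/-- pull the graph back to the naturals along an ordering of the vertices -/
def pullG {N : ℕ} (H : SimpleGraph (Fin n)) (e : Fin N ≃ Fin n) : SimpleGraph ℕ where
  Adj a b := ∃ (ha : a < N) (hb : b < N), H.Adj (e ⟨a, ha⟩) (e ⟨b, hb⟩)
  symm := ⟨fun _ _ ⟨ha, hb, h⟩ => ⟨hb, ha, h.symm⟩⟩
  loopless := ⟨fun _ ⟨_, _, h⟩ => H.loopless.irrefl _ h⟩

theorem pullG_adj {N : ℕ} (H : SimpleGraph (Fin n)) (e : Fin N ≃ Fin n) (a b : Fin N) :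
    (pullG H e).Adj a b ↔ H.Adj (e a) (e b) :=
  ⟨fun ⟨_, _, h⟩ => h, fun h => ⟨a.2, b.2, h⟩⟩

theorem DS_pull {N : ℕ} (H : SimpleGraph (Fin n)) (e : Fin N ≃ Fin n)
    (h1 : ∀ i j : Fin N, j < i → (i : ℕ) ≤ k → H.Adj (e i) (e j))
    (h2 : ∀ i : Fin N, k + 1 ≤ (i : ℕ) → {j : Fin N | j < i ∧ H.Adj (e i) (e j)}.ncard = k)
    (i : ℕ) (hi : i < N) : (DS (pullG H e) i).card = min i k := by
  by_cases hik : i ≤ k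
  · rw [min_eq_left hik]
    have : DS (pullG H e) i = univ := by
      rw [eq_univ_iff_forall]
      intro a
      rw [mem_DS]
      exact ⟨hi, a.2.trans hi, h1 ⟨i, hi⟩ ⟨a, a.2.trans hi⟩ a.2 hik⟩
    rw [this, card_univ, Fintype.card_fin]
  · rw [min_eq_right (by omega), ← h2 ⟨i, hi⟩ (by simp; omega),
      ← card_map (Fin.castLEEmb hi.le), ← Set.ncard_coe_finset]
    congr 1
    ext j
    rw [Finset.mem_coe, mem_map]
    constructor
    · rintro ⟨a, ha, rfl⟩
      obtain ⟨_, _, h⟩ := mem_DS.1 ha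
      exact ⟨a.2, h⟩
    · rintro ⟨hj, h⟩
      exact ⟨⟨j, hj⟩, mem_DS.2 ⟨hi, j.2, h⟩, rfl⟩

theorem T_image {N : ℕ} (hT : ∀ t ∈ T, t.IsSwap) (e : Fin N ≃ Fin n) {Tf : Finset (Perm (Fin n))}
    (hTf : ∀ t, t ∈ Tf ↔ t ∈ T) :
    Tf = (TS (pullG (transGraph T) e) N).image e.permCongr := by
  ext t
  rw [mem_image, hTf]
  constructor
  · intro ht
    obtain ⟨a, b, hab, rfl⟩ := hT t ht
    refine ⟨swap (e.symm a) (e.symm b), mem_TS.2 ⟨_, _, ?_, rfl⟩, ?_⟩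
    · rw [pullG_adj, tg_adj]; simpa using ⟨hab, ht⟩
    · rw [permCongr_swap']; simp
  · rintro ⟨u, hu, rfl⟩
    obtain ⟨a, b, hab, rfl⟩ := mem_TS.1 hu
    rw [pullG_adj, tg_adj] at hab
    rw [permCongr_swap']
    exact hab.2

theorem main (hn : 5 ≤ n) (hk2 : 2 ≤ k) (hkn : k ≤ n - 1) (hT : ∀ t ∈ T, t.IsSwap)
    (hkt : IsKTree k (transGraph T)) :
    rkConn (cayley T) 2 = 4 * (k * n - k * (k + 1) / 2) - 10 := by
  classical
  obtain ⟨-, e, h1, h2⟩ := hkt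
  revert h1 h2
  have hNn : Fintype.card (Fin n) = n := Fintype.card_fin n
  revert e
  generalize Fintype.card (Fin n) = N at hNn
  intro e h1 h2
  have hTf : ∀ t, t ∈ T.toFinset ↔ t ∈ T := fun t => Set.mem_toFinset
  set Tf := T.toFinset with hTfd
  have hD := DS_pull (transGraph T) e h1 (fun i hi => (h2 i hi).1)
  have him := T_image hT e hTf
  have hcard : Tf.card = (TS (pullG (transGraph T) e) N).card := by
    rw [him, card_image_of_injective _ e.permCongr.injective]
  have hH : Hole Tf 10 :=
    Hole.transport e him ((hole_weak hD hk2 N (by omega) le_rfl).2 (by omega))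
  have q1 := TS_ge hD hk2 N (by omega) le_rfl
  have q2 := TS_le hD N le_rfl
  have q3 := TS_eq2 hD N (by omega) le_rfl
  rw [← hcard] at q1 q2 q3
  have q4 := fact_aux n (by omega)
  rw [hNn] at q1 q2 q3
  have adj01 := h1 ⟨1, by omega⟩ ⟨0, by omega⟩ (by simp) (by simp; omega)
  have adj12 := h1 ⟨2, by omega⟩ ⟨1, by omega⟩ (by simp) (by simp; omega)
  have adj02 := h1 ⟨2, by omega⟩ ⟨0, by omega⟩ (by simp) (by simp; omega)
  rw [tg_adj] at adj01 adj12 adj02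
  obtain ⟨F, hF, hFc⟩ := upper hTf hT adj12.1 adj01.1 adj02.1 ((hTf _).2 adj12.2)
    ((hTf _).2 adj01.2) ((hTf _).2 adj02.2) (by omega) (by omega)
  have hval : 4 * (k * n - k * (k + 1) / 2) - 10 = 4 * Tf.card - 10 := by
    generalize k * (k + 1) = x at *
    generalize k * n = y at *
    omega
  rw [hval]
  unfold rkConn
  apply le_antisymm
  · refine le_trans (Nat.sInf_le ⟨F, hF, rfl⟩) ?_
    omega
  · obtain ⟨F', hF', hc⟩ := Nat.sInf_mem (s := {m : ℕ | ∃ F : Set (Perm (Fin n)),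
      IsRkCut (cayley T) 2 F ∧ F.ncard = m}) ⟨_, F, hF, rfl⟩
    rw [← hc]
    have := lower hTf hT hH (by omega) hF'
    omega

end final
end KT

/-- For integers `n ≥ 5` and `2 ≤ k ≤ n-1`, the `R_2`-vertex-connectivity of the
Cayley graph `T_kG_n` generated by a `k`-tree on `n` vertices equals
`4(kn - k(k+1)/2) - 10`. -/
theorem stmt0 (n k : ℕ) (hn : 5 ≤ n) (hk2 : 2 ≤ k) (hkn : k ≤ n - 1)
    (T : Set (Equiv.Perm (Fin n))) (hT : ∀ t ∈ T, Equiv.Perm.IsSwap t)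
    (hkt : IsKTree k (transGraph T)) :
    rkConn (cayley T) 2 = 4 * (k * n - k * (k + 1) / 2) - 10 :=
  KT.main hn hk2 hkn hT hkt
end

section
/- For integers n ≥ 5 and 2 ≤ k ≤ n−1, the R_1-vertex-connectivity of the Cayley graph T_kG_n generated by a k-tree on n vertices satisfies κ^1(T_kG_n) = 2(kn − k(k+1)/2) − 2. -/
section Iso
open Classical Finset

variable {V : Type*} [Fintype V] [DecidableEq V]

set_option linter.unusedSectionVars false

/-- closed neighbourhood -/
noncomputable def clN (G : SimpleGraph V) (X : Finset V) : Finset V :=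
  Finset.univ.filter (fun v => v ∈ X ∨ ∃ x ∈ X, G.Adj x v)

/-- `X` contains an edge -/
def HasEdge (G : SimpleGraph V) (X : Finset V) : Prop :=
  ∃ x ∈ X, ∃ y ∈ X, G.Adj x y

/-- boundary size -/
noncomputable def bd (G : SimpleGraph V) (X : Finset V) : ℕ := (clN G X).card - X.card

/-- edge on both sides -/
def Adm (G : SimpleGraph V) (X : Finset V) : Prop :=
  HasEdge G X ∧ HasEdge G (clN G X)ᶜ

theorem mem_clN {G : SimpleGraph V} {X : Finset V} {v : V} :
    v ∈ clN G X ↔ v ∈ X ∨ ∃ x ∈ X, G.Adj x v := by simp [clN]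

theorem subset_clN (G : SimpleGraph V) (X : Finset V) : X ⊆ clN G X := by
  intro x hx; exact mem_clN.2 (Or.inl hx)

theorem clN_mono (G : SimpleGraph V) {X Y : Finset V} (h : X ⊆ Y) : clN G X ⊆ clN G Y := by
  intro v hv
  rw [mem_clN] at *
  rcases hv with hv | ⟨x, hx, hv⟩
  · exact Or.inl (h hv)
  · exact Or.inr ⟨x, h hx, hv⟩

theorem HasEdge.mono {G : SimpleGraph V} {X Y : Finset V} (h : X ⊆ Y) (hX : HasEdge G X) :
    HasEdge G Y := by
  obtain ⟨x, hx, y, hy, hxy⟩ := hX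
  exact ⟨x, h hx, y, h hy, hxy⟩

theorem HasEdge.two_le {G : SimpleGraph V} {X : Finset V} (hX : HasEdge G X) : 2 ≤ X.card := by
  obtain ⟨x, hx, y, hy, hxy⟩ := hX
  exact Finset.one_lt_card.2 ⟨x, hx, y, hy, hxy.ne⟩

theorem clN_union (G : SimpleGraph V) (X Y : Finset V) :
    clN G (X ∪ Y) = clN G X ∪ clN G Y := by
  ext v
  simp only [mem_clN, mem_union]
  constructor
  · rintro ((h | h) | ⟨x, h | h, hv⟩)
    · exact Or.inl (Or.inl h)
    · exact Or.inr (Or.inl h)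
    · exact Or.inl (Or.inr ⟨x, h, hv⟩)
    · exact Or.inr (Or.inr ⟨x, h, hv⟩)
  · rintro ((h | ⟨x, h, hv⟩) | (h | ⟨x, h, hv⟩))
    · exact Or.inl (Or.inl h)
    · exact Or.inr ⟨x, Or.inl h, hv⟩
    · exact Or.inl (Or.inr h)
    · exact Or.inr ⟨x, Or.inr h, hv⟩

theorem bd_add (G : SimpleGraph V) (X : Finset V) : bd G X + X.card = (clN G X).card := by
  have := Finset.card_le_card (subset_clN G X)
  unfold bd; omega

theorem bd_submod (G : SimpleGraph V) (X Y : Finset V) :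
    bd G (X ∩ Y) + bd G (X ∪ Y) ≤ bd G X + bd G Y := by
  have h1 := bd_add G X
  have h2 := bd_add G Y
  have h3 := bd_add G (X ∩ Y)
  have h4 := bd_add G (X ∪ Y)
  have h5 := Finset.card_union_add_card_inter X Y
  have h6 := Finset.card_union_add_card_inter (clN G X) (clN G Y)
  have h7 : (clN G (X ∩ Y)).card ≤ (clN G X ∩ clN G Y).card :=
    Finset.card_le_card (Finset.subset_inter (clN_mono G Finset.inter_subset_left)
      (clN_mono G Finset.inter_subset_right))
  rw [clN_union] at h4
  omega

theorem clN_compl_subset (G : SimpleGraph V) (X : Finset V) : clN G (clN G X)ᶜ ⊆ Xᶜ := by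
  intro v hv
  rw [Finset.mem_compl]
  intro hvX
  rw [mem_clN] at hv
  rcases hv with hv | ⟨x, hx, hxv⟩
  · exact (Finset.mem_compl.1 hv) (subset_clN G X hvX)
  · exact (Finset.mem_compl.1 hx) (mem_clN.2 (Or.inr ⟨v, hvX, hxv.symm⟩))

theorem bd_star (G : SimpleGraph V) (X : Finset V) : bd G (clN G X)ᶜ ≤ bd G X := by
  have h1 := bd_add G X
  have h2 := bd_add G (clN G X)ᶜ
  have h3 := Finset.card_le_card (clN_compl_subset G X)
  have h4 := Finset.card_add_card_compl X
  have h5 := Finset.card_add_card_compl (clN G X)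
  omega

theorem Adm.star {G : SimpleGraph V} {X : Finset V} (h : Adm G X) : Adm G (clN G X)ᶜ := by
  refine ⟨h.2, h.1.mono ?_⟩
  have := clN_compl_subset G X
  intro x hx
  rw [Finset.mem_compl]
  intro hx'
  exact (Finset.mem_compl.1 (this hx')) hx

theorem atom_inter (G : SimpleGraph V) (K : ℕ)
    (hI : ∀ I : Finset V, 3 ≤ I.card → ¬ HasEdge G I → K ≤ bd G I)
    (A B : Finset V) (hA : Adm G A) (hB : Adm G B)
    (hmin : ∀ X, Adm G X → bd G A ≤ bd G X)
    (hmin2 : ∀ X, Adm G X → bd G X = bd G A → A.card ≤ X.card)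
    (hBA : bd G B = bd G A) (hc : B.card = A.card) (hK : bd G A < K)
    (he : HasEdge G (A ∩ B)) : A = B := by
  have hsub := bd_submod G A B
  have hadm : Adm G (A ∩ B) := by
    refine ⟨he, hA.2.mono ?_⟩
    exact Finset.compl_subset_compl.2 (clN_mono G Finset.inter_subset_left)
  have h1 := hmin _ hadm
  have hfin : A.card ≤ (A ∩ B).card → A = B := by
    intro h
    have e1 : A ∩ B = A := Finset.eq_of_subset_of_card_le Finset.inter_subset_left h
    have e2 : A ∩ B = B := Finset.eq_of_subset_of_card_le Finset.inter_subset_right (by omega)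
    rw [← e1, e2]
  by_cases hE : HasEdge G (clN G (A ∪ B))ᶜ
  · have h2 := hmin (A ∪ B) ⟨hA.1.mono Finset.subset_union_left, hE⟩
    exact hfin (hmin2 _ hadm (by omega))
  · by_contra hne
    have hlt : (A ∩ B).card < A.card := by
      by_contra h
      exact hne (hfin (by omega))
    have h3 : bd G (A ∩ B) ≠ bd G A := fun h => by
      have := hmin2 _ hadm h
      omega
    have hs := bd_star G A
    have h4 := hmin2 _ hA.star (le_antisymm hs (hmin _ hA.star))
    have h5 := bd_add G A
    have h6 := bd_add G (A ∪ B)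
    have h7 := Finset.card_add_card_compl (clN G A)
    have h8 := Finset.card_add_card_compl (clN G (A ∪ B))
    have h9 := Finset.card_union_add_card_inter A B
    have h10 := he.two_le
    have h11 := hI _ (by omega) hE
    have h12 := bd_star G (A ∪ B)
    omega

theorem clN_map (G : SimpleGraph V) (φ : V ≃ V) (hφ : ∀ x y, G.Adj (φ x) (φ y) ↔ G.Adj x y)
    (X : Finset V) : clN G (X.map φ.toEmbedding) = (clN G X).map φ.toEmbedding := by
  ext v
  obtain ⟨w, rfl⟩ := φ.surjective v
  have h : ∀ (Y : Finset V) (x : V), φ x ∈ Y.map φ.toEmbedding ↔ x ∈ Y := by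
    intro Y x; simp
  rw [h, mem_clN, mem_clN, h]
  refine or_congr Iff.rfl ⟨?_, ?_⟩
  · rintro ⟨x, hx, hxw⟩
    obtain ⟨y, rfl⟩ := φ.surjective x
    exact ⟨y, (h X y).1 hx, (hφ _ _).1 hxw⟩
  · rintro ⟨y, hy, hyw⟩
    exact ⟨φ y, (h X y).2 hy, (hφ _ _).2 hyw⟩

theorem HasEdge.map {G : SimpleGraph V} (φ : V ≃ V)
    (hφ : ∀ x y, G.Adj (φ x) (φ y) ↔ G.Adj x y)
    {X : Finset V} (h : HasEdge G X) : HasEdge G (X.map φ.toEmbedding) := by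
  obtain ⟨x, hx, y, hy, hxy⟩ := h
  exact ⟨φ x, by simpa using hx, φ y, by simpa using hy, (hφ x y).2 hxy⟩

theorem bd_map (G : SimpleGraph V) (φ : V ≃ V) (hφ : ∀ x y, G.Adj (φ x) (φ y) ↔ G.Adj x y)
    (X : Finset V) : bd G (X.map φ.toEmbedding) = bd G X := by
  simp [bd, clN_map G φ hφ]

theorem Adm.map {G : SimpleGraph V} (φ : V ≃ V)
    (hφ : ∀ x y, G.Adj (φ x) (φ y) ↔ G.Adj x y)
    {X : Finset V} (h : Adm G X) : Adm G (X.map φ.toEmbedding) := by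
  refine ⟨h.1.map φ hφ, ?_⟩
  have := h.2.map φ hφ
  rw [clN_map G φ hφ]
  refine this.mono ?_
  intro v hv
  obtain ⟨w, rfl⟩ := φ.surjective v
  simpa using hv

theorem exists_atom (G : SimpleGraph V) (X : Finset V) (hX : Adm G X) :
    ∃ A, Adm G A ∧ bd G A ≤ bd G X ∧ (∀ Y, Adm G Y → bd G A ≤ bd G Y) ∧
      (∀ Y, Adm G Y → bd G Y = bd G A → A.card ≤ Y.card) := by
  obtain ⟨B, hB, hBm⟩ := Finset.exists_min_image
    ((Finset.univ : Finset (Finset V)).filter (fun Y => Adm G Y)) (bd G) ⟨X, by simpa using hX⟩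
  simp only [mem_filter, mem_univ, true_and] at hB hBm
  obtain ⟨A, hA, hAm⟩ := Finset.exists_min_image
    ((Finset.univ : Finset (Finset V)).filter (fun Y => Adm G Y ∧ bd G Y = bd G B)) Finset.card
    ⟨B, by simpa using hB⟩
  simp only [mem_filter, mem_univ, true_and] at hA hAm
  refine ⟨A, hA.1, hA.2 ▸ hBm X hX, fun Y hY => hA.2 ▸ hBm Y hY, fun Y hY h => ?_⟩
  exact hAm Y ⟨hY, h.trans hA.2⟩

end Iso

section Cay
open Classical Finset Equiv Equiv.Perm

variable {n : ℕ}

theorem cayley_adj {T : Set (Perm (Fin n))} (hT : ∀ t ∈ T, IsSwap t) (g h : Perm (Fin n)) :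
    (cayley T).Adj g h ↔ ∃ t ∈ T, h = g * t := by
  unfold cayley
  rw [SimpleGraph.fromRel_adj]
  constructor
  · rintro ⟨_, h | ⟨t, ht, rfl⟩⟩
    · exact h
    · refine ⟨t, ht, ?_⟩
      obtain ⟨a, b, _, rfl⟩ := hT t ht
      simp [mul_assoc]
  · rintro ⟨t, ht, rfl⟩
    refine ⟨?_, Or.inl ⟨t, ht, rfl⟩⟩
    obtain ⟨a, b, hab, rfl⟩ := hT t ht
    intro h
    have h1 : swap a b = 1 := by simpa using h
    exact hab (swap_eq_one_iff.1 h1)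

theorem swap_factor {w : Perm (Fin n)} {x : Fin n} (hx : w x ≠ x) {t t' : Perm (Fin n)}
    (ht : IsSwap t) (ht' : IsSwap t') (hw : w = t * t') :
    t = swap x (w x) ∨ t = w * swap x (w x) ∨ t = swap (w⁻¹ x) (w x) := by
  obtain ⟨a, b, hab, rfl⟩ := ht
  obtain ⟨c, d, hcd, rfl⟩ := ht'
  have key : ∀ (p q : Fin n) (y : Fin n), swap p q y ≠ y → swap p q = swap y (swap p q y) := by
    intro p q y h
    rcases eq_or_ne y p with rfl | h1
    · simp
    · rcases eq_or_ne y q with rfl | h2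
      · simp [swap_comm]
      · exact absurd (swap_apply_of_ne_of_ne h1 h2) h
  have hwx : w x = swap a b (swap c d x) := by rw [hw]; rfl
  by_cases h1 : swap c d x = x
  · left
    rw [h1] at hwx
    rw [hwx] at hx ⊢
    exact key a b x hx
  · have k1 := key c d x h1
    generalize hz : swap c d x = z at *
    by_cases h2 : swap a b z = z
    · right; left
      rw [hwx, h2, ← k1, hw]
      simp [mul_assoc]
    · right; right
      have k2 := key a b z h2
      have hwz : w z = x := by
        rw [hw, k1, Perm.mul_apply, swap_apply_right, k2]
        refine swap_apply_of_ne_of_ne (Ne.symm h1) ?_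
        rw [← hwx]; exact hx.symm
      have : w⁻¹ x = z := by rw [← hwz]; simp
      rw [this, hwx]
      exact k2

/-- neighbours in the Cayley graph -/
noncomputable def nbrs (T : Set (Perm (Fin n))) (g : Perm (Fin n)) : Finset (Perm (Fin n)) :=
  T.toFinset.image (fun t => g * t)

theorem mem_nbrs {T : Set (Perm (Fin n))} {g h : Perm (Fin n)} :
    h ∈ nbrs T g ↔ ∃ t ∈ T, h = g * t := by
  unfold nbrs
  rw [mem_image]
  constructor
  · rintro ⟨t, ht, rfl⟩
    exact ⟨t, by simpa using ht, rfl⟩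
  · rintro ⟨t, ht, rfl⟩
    exact ⟨t, by simpa using ht, rfl⟩

theorem card_nbrs (T : Set (Perm (Fin n))) (g : Perm (Fin n)) :
    (nbrs T g).card = T.toFinset.card :=
  Finset.card_image_of_injective _ (mul_right_injective g)

theorem card_common {T : Set (Perm (Fin n))} (hT : ∀ t ∈ T, IsSwap t) {g h : Perm (Fin n)}
    (hgh : g ≠ h) : (nbrs T g ∩ nbrs T h).card ≤ 3 := by
  have hw : g⁻¹ * h ≠ 1 := by
    intro h1
    exact hgh (inv_mul_eq_one.1 h1)
  obtain ⟨x, hx⟩ : ∃ x, (g⁻¹ * h) x ≠ x := by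
    by_contra hcon
    push Not at hcon
    exact hw (Equiv.ext hcon)
  generalize hwd : g⁻¹ * h = w at *
  refine le_trans (Finset.card_le_card
    (t := {g * swap x (w x), g * (w * swap x (w x)), g * swap (w⁻¹ x) (w x)}) ?_) card_le_three
  intro u hu
  rw [mem_inter, mem_nbrs, mem_nbrs] at hu
  obtain ⟨⟨t, ht, rfl⟩, t', ht', hu⟩ := hu
  have hwt : w = t * t' := by
    have hh : h = g * t * t' := by
      rw [hu]
      obtain ⟨a, b, _, rfl⟩ := hT t' ht'
      simp [mul_assoc]
    rw [← hwd, hh]; group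
  rcases swap_factor hx (hT t ht) (hT t' ht') hwt with h | h | h
  · rw [← h]; simp
  · rw [← h]; simp
  · rw [← h]; simp

theorem indep_bd {T : Set (Perm (Fin n))} (hT : ∀ t ∈ T, IsSwap t)
    (h7 : 7 ≤ T.toFinset.card) (I : Finset (Perm (Fin n))) (h3 : 3 ≤ I.card)
    (hI : ¬ HasEdge (cayley T) I) : 2 * T.toFinset.card - 2 ≤ bd (cayley T) I := by
  obtain ⟨x, y, z, hx, hy, hz, hxy, hxz, hyz⟩ := Finset.two_lt_card_iff.1 (show 2 < I.card by omega)
  have hsub : ∀ v ∈ I, nbrs T v ⊆ clN (cayley T) I \ I := by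
    intro v hv u hu
    have hadj := (cayley_adj hT v u).2 (mem_nbrs.1 hu)
    rw [mem_sdiff, mem_clN]
    exact ⟨Or.inr ⟨v, hv, hadj⟩, fun hu' => hI ⟨v, hv, u, hu', hadj⟩⟩
  have hle := Finset.card_le_card
    (Finset.union_subset (Finset.union_subset (hsub x hx) (hsub y hy)) (hsub z hz))
  rw [Finset.card_sdiff_of_subset (subset_clN _ _)] at hle
  change _ ≤ bd (cayley T) I at hle
  have e1 := Finset.card_union_add_card_inter (nbrs T x) (nbrs T y)
  have e2 := Finset.card_union_add_card_inter (nbrs T x ∪ nbrs T y) (nbrs T z)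
  rw [Finset.union_inter_distrib_right] at e2
  have e3 := Finset.card_union_le (nbrs T x ∩ nbrs T z) (nbrs T y ∩ nbrs T z)
  have c1 := card_common hT hxy
  have c2 := card_common hT hxz
  have c3 := card_common hT hyz
  simp only [card_nbrs] at e1 e2
  omega

theorem left_adj {T : Set (Perm (Fin n))} (hT : ∀ t ∈ T, IsSwap t) (g x y : Perm (Fin n)) :
    (cayley T).Adj (Equiv.mulLeft g x) (Equiv.mulLeft g y) ↔ (cayley T).Adj x y := by
  simp [cayley_adj hT, mul_assoc]

theorem swap_prod_mem {S : Set (Perm (Fin n))} (hS : ∀ t ∈ S, IsSwap t) {t t' : Perm (Fin n)}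
    (ht : IsSwap t) (ht' : IsSwap t') (hne : t ≠ t') (h : t' * t ∈ Subgroup.closure S) :
    t ∈ Subgroup.closure S := by
  obtain ⟨a, b, hab, rfl⟩ := ht
  obtain ⟨c, d, hcd, rfl⟩ := ht'
  rw [swap_mem_closure_isSwap hS]
  by_cases h1 : swap c d b = b
  · have : (swap c d * swap a b) a = b := by simp [h1]
    have h2 : b ∈ MulAction.orbit (Subgroup.closure S) a := ⟨⟨_, h⟩, this⟩
    exact MulAction.mem_orbit_symm.1 h2
  by_cases h2 : swap c d a = a
  · have : (swap c d * swap a b) b = a := by simp [h2]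
    exact ⟨⟨_, h⟩, this⟩
  exfalso
  apply hne
  have f1 : b = c ∨ b = d := by
    by_contra hcon
    push Not at hcon
    exact h1 (swap_apply_of_ne_of_ne hcon.1 hcon.2)
  have f2 : a = c ∨ a = d := by
    by_contra hcon
    push Not at hcon
    exact h2 (swap_apply_of_ne_of_ne hcon.1 hcon.2)
  rcases f1 with rfl | rfl <;> rcases f2 with rfl | rfl
  · exact absurd rfl hab
  · exact swap_comm _ _
  · rfl
  · exact absurd rfl hab

theorem sign_isSwap {t : Perm (Fin n)} (ht : IsSwap t) : sign t = -1 := by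
  obtain ⟨a, b, hab, rfl⟩ := ht
  exact sign_swap hab

theorem two_mul_card_le (H : Subgroup (Perm (Fin n))) (S : Finset (Perm (Fin n)))
    (hS : ∀ t ∈ S, IsSwap t) (hSH : ∀ t ∈ S, t ∈ H) (hne : S.Nonempty) :
    2 * S.card ≤ (univ.filter (fun g => g ∈ H)).card := by
  obtain ⟨s, hs⟩ := hne
  have hdisj : Disjoint S (S.image (fun t => s * t)) := by
    rw [Finset.disjoint_left]
    intro t ht ht'
    obtain ⟨u, hu, rfl⟩ := mem_image.1 ht'
    have h1 := sign_isSwap (hS _ ht)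
    rw [Perm.sign_mul, sign_isSwap (hS _ hs), sign_isSwap (hS _ hu)] at h1
    exact absurd h1 (by decide)
  have hc : (S.image (fun t => s * t)).card = S.card :=
    Finset.card_image_of_injective _ (mul_right_injective s)
  have := Finset.card_le_card (s := S ∪ S.image (fun t => s * t))
    (t := univ.filter (fun g => g ∈ H)) (by
      intro g hg
      rw [mem_filter]
      refine ⟨mem_univ _, ?_⟩
      rcases mem_union.1 hg with hg | hg
      · exact hSH g hg
      · obtain ⟨u, hu, rfl⟩ := mem_image.1 hg
        exact H.mul_mem (hSH _ hs) (hSH _ hu))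
  rw [Finset.card_union_of_disjoint hdisj, hc] at this
  omega

theorem main_lower {T : Set (Perm (Fin n))} (hT : ∀ t ∈ T, IsSwap t)
    (h7 : 7 ≤ T.toFinset.card) (htop : Subgroup.closure T = ⊤)
    (X : Finset (Perm (Fin n))) (hX : Adm (cayley T) X) :
    2 * T.toFinset.card - 2 ≤ bd (cayley T) X := by
  by_contra hlt
  push Not at hlt
  obtain ⟨A0, hA0, hA0X, hmin0, hmin0'⟩ := exists_atom (cayley T) X hX
  have hcard_map : ∀ (g : Perm (Fin n)) (B : Finset (Perm (Fin n))),
    (B.map (Equiv.mulLeft g).toEmbedding).card = B.card := fun g B => Finset.card_map _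
  obtain ⟨x0, hx0, y0, hy0, hxy0⟩ := hA0.1
  obtain ⟨s0, hs0, rfl⟩ := (cayley_adj hT _ _).1 hxy0
  obtain ⟨A, hAdef⟩ : ∃ A, A = A0.map (Equiv.mulLeft x0⁻¹).toEmbedding := ⟨_, rfl⟩
  have hA : Adm (cayley T) A := hAdef ▸ hA0.map _ (left_adj hT x0⁻¹)
  have hbA : bd (cayley T) A = bd (cayley T) A0 := hAdef ▸ bd_map _ _ (left_adj hT x0⁻¹) A0
  have hcA : A.card = A0.card := hAdef ▸ hcard_map _ _
  have hone : (1 : Perm (Fin n)) ∈ A := by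
    rw [hAdef, mem_map]; exact ⟨x0, hx0, by simp⟩
  have hs0A : s0 ∈ A := by
    rw [hAdef, mem_map]; exact ⟨x0 * s0, hy0, by simp⟩
  have hinv : ∀ s ∈ T, s ∈ A → A.map (Equiv.mulLeft s).toEmbedding = A := by
    intro s hs hsA
    symm
    refine atom_inter (cayley T) _ (indep_bd hT h7) A _ hA (hA.map _ (left_adj hT s))
      (fun Y hY => hbA ▸ hmin0 Y hY) (fun Y hY h => hcA ▸ hmin0' Y hY (h.trans hbA))
      (bd_map _ _ (left_adj hT s) A) (hcard_map _ _) (by omega) ?_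
    have hss : s * s = 1 := by
      obtain ⟨a, b, _, rfl⟩ := hT s hs
      simp
    refine ⟨1, ?_, s, ?_, (cayley_adj hT _ _).2 ⟨s, hs, by simp⟩⟩
    · rw [mem_inter, mem_map]
      exact ⟨hone, s, hsA, by simpa using hss⟩
    · rw [mem_inter, mem_map]
      exact ⟨hsA, 1, hone, by simp⟩
  have hinv' : ∀ h ∈ Subgroup.closure (T ∩ (A : Set (Perm (Fin n)))), ∀ a, h * a ∈ A ↔ a ∈ A := by
    intro h hh
    induction hh using Subgroup.closure_induction with
    | mem s hs =>
      intro a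
      have := hinv s hs.1 (by simpa using hs.2)
      conv_lhs => rw [← this]
      simp
    | one => simp
    | mul x y _ _ hx hy => intro a; rw [mul_assoc, hx, hy]
    | inv x _ hx => intro a; rw [← hx]; simp
  obtain ⟨H, hH⟩ : ∃ H, H = Subgroup.closure (T ∩ (A : Set (Perm (Fin n)))) := ⟨_, rfl⟩
  rw [← hH] at hinv'
  have hSsw : ∀ t ∈ T ∩ (A : Set (Perm (Fin n))), IsSwap t := fun t ht => hT t ht.1
  have hHA : ∀ h ∈ H, h ∈ A := fun h hh => by
    have := (hinv' h hh 1).2 hone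
    simpa using this
  have hTA : ∀ t ∈ T, t ∈ A → t ∈ H := fun t ht hA => hH ▸ Subgroup.subset_closure ⟨ht, hA⟩
  let S : Finset (Perm (Fin n)) := T.toFinset.filter (fun t => t ∈ A)
  let R : Finset (Perm (Fin n)) := T.toFinset.filter (fun t => ¬ t ∈ A)
  have hSR : S.card + R.card = T.toFinset.card := Finset.card_filter_add_card_filter_not _
  let HF : Finset (Perm (Fin n)) := univ.filter (fun g => g ∈ H)
  have hS0 : S.Nonempty := ⟨s0, by simp [S, hs0, hs0A]⟩
  have hHS : 2 * S.card ≤ HF.card := by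
    refine two_mul_card_le H S (fun t ht => ?_) (fun t ht => ?_) hS0
    · exact hT t (by simpa using (mem_filter.1 ht).1)
    · exact hTA t (by simpa using (mem_filter.1 ht).1) (mem_filter.1 ht).2
  have hR0 : R.Nonempty := by
    by_contra hR
    rw [Finset.not_nonempty_iff_eq_empty] at hR
    have hTle : ∀ t ∈ T, t ∈ A := by
      intro t ht
      by_contra hcon
      have : t ∈ R := by simp [R, ht, hcon]
      simp [hR] at this
    have hHtop : H = ⊤ := by
      rw [eq_top_iff, ← htop, Subgroup.closure_le]
      intro t ht
      exact hTA t ht (hTle t ht)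
    obtain ⟨x, hx, _⟩ := hA.2
    refine (Finset.mem_compl.1 hx) (subset_clN _ _ (hHA x ?_))
    rw [hHtop]; trivial
  have himg : ((HF ×ˢ R).image (fun p => p.1 * p.2)).card = HF.card * R.card := by
    rw [← Finset.card_product]
    apply Finset.card_image_of_injOn
    rintro ⟨h, t⟩ hp ⟨h', t'⟩ hp' heq
    simp only [coe_product, Set.mem_prod, mem_coe] at hp hp'
    have hh : h ∈ H := by simpa [HF] using hp.1
    have hh' : h' ∈ H := by simpa [HF] using hp'.1
    obtain ⟨htT, htA⟩ : t ∈ T ∧ t ∉ A := by simpa [R] using hp.2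
    obtain ⟨htT', htA'⟩ : t' ∈ T ∧ t' ∉ A := by simpa [R] using hp'.2
    simp only at heq
    have htt : t = t' := by
      by_contra hne
      apply htA
      apply hHA
      rw [hH]
      refine swap_prod_mem hSsw (hT t htT) (hT t' htT') hne ?_
      rw [← hH]
      have hinv : t⁻¹ = t := by
        obtain ⟨a, b, _, rfl⟩ := hT t htT
        simp
      have : t' * t = h'⁻¹ * h := by
        have e : h = h' * t' * t⁻¹ := by rw [← heq]; group
        rw [e, hinv]; group
      rw [this]
      exact H.mul_mem (H.inv_mem hh') hh
    subst htt
    rw [mul_right_cancel heq]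
  have hsub : (HF ×ˢ R).image (fun p => p.1 * p.2) ⊆ clN (cayley T) A \ A := by
    intro u hu
    obtain ⟨⟨h, t⟩, hp, rfl⟩ := mem_image.1 hu
    rw [mem_product] at hp
    have hh : h ∈ H := by simpa [HF] using hp.1
    obtain ⟨htT, htA⟩ : t ∈ T ∧ t ∉ A := by simpa [R] using hp.2
    rw [mem_sdiff, mem_clN]
    refine ⟨Or.inr ⟨h, hHA h hh, (cayley_adj hT _ _).2 ⟨t, htT, rfl⟩⟩, ?_⟩
    simp only
    rw [hinv' h hh]
    exact htA
  have hle := Finset.card_le_card hsub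
  rw [himg, Finset.card_sdiff_of_subset (subset_clN _ _)] at hle
  change _ ≤ bd (cayley T) A at hle
  have hs1 : 1 ≤ S.card := hS0.card_pos
  have hr1 : 1 ≤ R.card := hR0.card_pos
  have : 2 * (S.card + R.card) - 2 ≤ HF.card * R.card := by
    obtain ⟨a, ha⟩ : ∃ a, S.card = a + 1 := ⟨S.card - 1, by omega⟩
    obtain ⟨b, hb⟩ : ∃ b, R.card = b + 1 := ⟨R.card - 1, by omega⟩
    have hm := Nat.mul_le_mul_right R.card hHS
    rw [ha, hb] at *
    have : 2 * (a + 1 + (b + 1)) - 2 ≤ 2 * (a + 1) * (b + 1) := by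
      have : 2 * (a + 1 + (b + 1)) - 2 = 2 * (a + b + 1) := by omega
      rw [this]; nlinarith [Nat.zero_le (a * b)]
    omega
  omega

theorem lower_cut {T : Set (Perm (Fin n))} (hT : ∀ t ∈ T, IsSwap t)
    (h7 : 7 ≤ T.toFinset.card) (htop : Subgroup.closure T = ⊤)
    (hfac : 2 * T.toFinset.card < n.factorial)
    (F : Set (Perm (Fin n))) (hF : IsRkCut (cayley T) 1 F) :
    2 * T.toFinset.card - 2 ≤ F.ncard := by
  obtain ⟨hF1, hF2⟩ := hF
  have hdeg : ∀ v, v ∉ F → ∃ u, u ∉ F ∧ (cayley T).Adj v u := by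
    intro v hv
    have := hF2 v hv
    exact (Set.ncard_pos (Set.toFinite _)).1 this
  by_cases hU : F = Set.univ
  · subst hU
    rw [Set.ncard_univ, Nat.card_eq_fintype_card, Fintype.card_perm, Fintype.card_fin]
    omega
  obtain ⟨w, hw⟩ := (Set.ne_univ_iff_exists_notMem F).1 hU
  have hnp : ¬ ((cayley T).induce (Fᶜ : Set (Perm (Fin n)))).Preconnected := by
    intro hp
    have : Nonempty (Fᶜ : Set (Perm (Fin n))) := ⟨⟨w, hw⟩⟩
    exact hF1 ⟨hp⟩
  unfold SimpleGraph.Preconnected at hnp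
  push Not at hnp
  obtain ⟨u, v, huv⟩ := hnp
  let X : Finset (Perm (Fin n)) := univ.filter (fun x => ∃ h : x ∈ Fᶜ,
    ((cayley T).induce (Fᶜ : Set (Perm (Fin n)))).Reachable u ⟨x, h⟩)
  have hXm : ∀ x, x ∈ X ↔ ∃ h : x ∈ Fᶜ,
    ((cayley T).induce (Fᶜ : Set (Perm (Fin n)))).Reachable u ⟨x, h⟩ := by
    intro x; simp [X]
  have hstep : ∀ x y, x ∈ X → (cayley T).Adj x y → y ∉ F → y ∈ X := by
    intro x y hx hxy hy
    obtain ⟨h, hr⟩ := (hXm x).1 hx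
    refine (hXm y).2 ⟨hy, hr.trans (SimpleGraph.Adj.reachable ?_)⟩
    simpa using hxy
  have huX : u.1 ∈ X := (hXm _).2 ⟨u.2, SimpleGraph.Reachable.refl _⟩
  have hvX : v.1 ∉ X := fun h => by
    obtain ⟨_, h⟩ := (hXm _).1 h
    exact huv h
  have hstar : ∀ y, y ∉ F → y ∉ X → y ∈ (clN (cayley T) X)ᶜ := by
    intro y hy hyX
    rw [mem_compl, mem_clN]
    rintro (h | ⟨x, hx, hxy⟩)
    · exact hyX h
    · exact hyX (hstep x y hx hxy hy)
  have hadm : Adm (cayley T) X := by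
    constructor
    · obtain ⟨u', hu', hadj⟩ := hdeg u.1 u.2
      exact ⟨u.1, huX, u', hstep _ _ huX hadj hu', hadj⟩
    · obtain ⟨v', hv', hadj⟩ := hdeg v.1 v.2
      exact ⟨v.1, hstar _ v.2 hvX, v', hstar _ hv' (fun h => hvX (hstep _ _ h hadj.symm v.2)), hadj⟩
  have hmain := main_lower hT h7 htop X hadm
  have hsub : clN (cayley T) X \ X ⊆ F.toFinset := by
    intro y hy
    rw [mem_sdiff] at hy
    rw [Set.mem_toFinset]
    by_contra hyF
    exact (mem_compl.1 (hstar y hyF hy.2)) hy.1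
  have hle := Finset.card_le_card hsub
  rw [Finset.card_sdiff_of_subset (subset_clN _ _)] at hle
  change bd (cayley T) X ≤ _ at hle
  rw [Set.ncard_eq_toFinset_card']
  omega

theorem upper_cut {T : Set (Perm (Fin n))} (hT : ∀ t ∈ T, IsSwap t)
    (h7 : 7 ≤ T.toFinset.card) (hfac : 2 * T.toFinset.card < n.factorial) :
    ∃ F : Set (Perm (Fin n)), IsRkCut (cayley T) 1 F ∧ F.ncard = 2 * T.toFinset.card - 2 := by
  obtain ⟨s, hs⟩ : T.toFinset.Nonempty := Finset.card_pos.1 (by omega)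
  have hsT : s ∈ T := by simpa using hs
  have hss : s * s = 1 := by
    obtain ⟨a, b, _, rfl⟩ := hT s hsT
    simp
  have hadj1 : (cayley T).Adj 1 s := (cayley_adj hT _ _).2 ⟨s, hsT, by simp⟩
  have hdis : ∀ t ∈ T, ∀ t' ∈ T, t ≠ s * t' := by
    intro t ht t' ht' h
    have h1 := sign_isSwap (hT _ ht)
    rw [h, Perm.sign_mul, sign_isSwap (hT _ hsT), sign_isSwap (hT _ ht')] at h1
    exact absurd h1 (by decide)
  have h1T : (1 : Perm (Fin n)) ∉ T := by
    intro h
    have := sign_isSwap (hT _ h)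
    rw [Perm.sign_one] at this
    exact absurd this (by decide)
  let P := T.toFinset.erase s
  let FF : Finset (Perm (Fin n)) := P ∪ P.image (fun t => s * t)
  have hP : P.card = T.toFinset.card - 1 := Finset.card_erase_of_mem hs
  have hPm : ∀ t, t ∈ P ↔ t ≠ s ∧ t ∈ T := by intro t; simp [P]
  have hFFc : FF.card = 2 * T.toFinset.card - 2 := by
    rw [Finset.card_union_of_disjoint, Finset.card_image_of_injective _ (mul_right_injective s), hP]
    · omega
    · rw [Finset.disjoint_left]
      intro t ht ht'
      obtain ⟨t', ht'', h⟩ := mem_image.1 ht'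
      exact hdis t ((hPm t).1 ht).2 t' ((hPm t').1 ht'').2 h.symm
  have hFFm : ∀ u, u ∈ FF ↔ u ≠ 1 ∧ u ≠ s ∧ ((cayley T).Adj 1 u ∨ (cayley T).Adj s u) := by
    intro u
    simp only [FF, mem_union, mem_image, hPm, cayley_adj hT]
    constructor
    · rintro (⟨h1, h2⟩ | ⟨t, ⟨h1, h2⟩, rfl⟩)
      · exact ⟨fun h => h1T (h ▸ h2), h1, Or.inl ⟨u, h2, by simp⟩⟩
      · refine ⟨fun h => h1 ?_, fun h => ?_, Or.inr ⟨t, h2, rfl⟩⟩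
        · exact mul_left_cancel (h.trans hss.symm)
        · exact hdis s hsT t h2 h.symm
    · rintro ⟨h1, h2, ⟨t, ht, rfl⟩ | ⟨t, ht, rfl⟩⟩
      · left; simpa using ⟨by simpa using h2, ht⟩
      · right
        exact ⟨t, ⟨fun h => h1 (by rw [h, hss]), ht⟩, rfl⟩
  refine ⟨(FF : Set (Perm (Fin n))), ⟨?_, ?_⟩, by rw [Set.ncard_coe_finset, hFFc]⟩
  · intro hcon
    have h1F : (1 : Perm (Fin n)) ∈ ((FF : Set (Perm (Fin n)))ᶜ) := by
      simp only [Set.mem_compl_iff, mem_coe, hFFm]; tauto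
    obtain ⟨v, hv⟩ : ∃ v, v ∉ FF ∪ {1, s} := by
      by_contra hall
      push Not at hall
      have : (univ : Finset (Perm (Fin n))).card ≤ (FF ∪ {1, s}).card :=
        Finset.card_le_card (fun v _ => hall v)
      rw [Finset.card_univ, Fintype.card_perm, Fintype.card_fin] at this
      have h2 := Finset.card_union_le FF {1, s}
      have h3 : ({1, s} : Finset (Perm (Fin n))).card ≤ 2 := Finset.card_le_two
      omega
    simp only [mem_union, mem_insert, mem_singleton, not_or] at hv
    obtain ⟨hvF, hv1, hvs⟩ := hv
    have hr := hcon.preconnected ⟨1, h1F⟩ ⟨v, by simpa using hvF⟩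
    obtain ⟨p⟩ := hr
    have key : ∀ (a b : ((FF : Set (Perm (Fin n)))ᶜ : Set (Perm (Fin n)))),
        ((cayley T).induce ((FF : Set (Perm (Fin n)))ᶜ)).Walk a b →
        (a.1 = 1 ∨ a.1 = s) → (b.1 = 1 ∨ b.1 = s) := by
      intro a b p
      induction p with
      | nil => exact id
      | @cons a c b hac _ ih =>
        intro ha
        apply ih
        by_contra hc
        push Not at hc
        have hc2 : c.1 ∉ FF := fun h => c.2 (Finset.mem_coe.2 h)
        apply hc2
        have hac' : (cayley T).Adj a.1 c.1 := by simpa using hac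
        rw [hFFm]
        refine ⟨hc.1, hc.2, ?_⟩
        rcases ha with ha | ha
        · left; rwa [ha] at hac'
        · right; rwa [ha] at hac'
    rcases key _ _ p (Or.inl rfl) with h | h
    · exact hv1 h
    · exact hvs h
  · intro v hv
    have hv : v ∉ FF := by simpa using hv
    suffices h : ∃ u, u ∉ FF ∧ (cayley T).Adj v u by
      obtain ⟨u, hu, hvu⟩ := h
      refine (Set.ncard_pos (Set.toFinite _)).2 ⟨u, ?_, hvu⟩
      simpa using hu
    by_cases hv1 : v = 1
    · exact ⟨s, by rw [hFFm]; tauto, hv1 ▸ hadj1⟩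
    by_cases hvs : v = s
    · exact ⟨1, by rw [hFFm]; tauto, hvs ▸ hadj1.symm⟩
    by_contra hcon
    push Not at hcon
    have hsub : nbrs T v ⊆ (nbrs T v ∩ nbrs T 1) ∪ (nbrs T v ∩ nbrs T s) := by
      intro u hu
      have hu' := (cayley_adj hT v u).2 (mem_nbrs.1 hu)
      have hF : u ∈ FF := by
        by_contra h
        exact hcon u h hu'
      rw [← Finset.inter_union_distrib_left, mem_inter, mem_union]
      refine ⟨hu, ((hFFm u).1 hF).2.2.imp (fun h => ?_) (fun h => ?_)⟩
      · exact mem_nbrs.2 ((cayley_adj hT _ _).1 h)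
      · exact mem_nbrs.2 ((cayley_adj hT _ _).1 h)
    have h1 := Finset.card_le_card hsub
    have h2 := Finset.card_union_le (nbrs T v ∩ nbrs T 1) (nbrs T v ∩ nbrs T s)
    have h3 := card_common hT hv1
    have h4 := card_common hT hvs
    rw [card_nbrs] at h1
    omega

theorem transGraph_adj {T : Set (Perm (Fin n))} (i j : Fin n) :
    (transGraph T).Adj i j ↔ i ≠ j ∧ swap i j ∈ T := by
  unfold transGraph
  rw [SimpleGraph.fromRel_adj, swap_comm j i, or_self]

theorem closure_top {T : Set (Perm (Fin n))} (hT : ∀ t ∈ T, IsSwap t) (k : ℕ) (hk : 1 ≤ k)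
    (hkt : IsKTree k (transGraph T)) : Subgroup.closure T = ⊤ := by
  obtain ⟨hcard, e, he1, he2⟩ := hkt
  have hpos : 0 < Fintype.card (Fin n) := by omega
  have horb : ∀ m : ℕ, ∀ hm : m < Fintype.card (Fin n),
      e ⟨m, hm⟩ ∈ MulAction.orbit (Subgroup.closure T) (e ⟨0, hpos⟩) := by
    intro m
    induction m using Nat.strong_induction_on with
    | _ m ih =>
      intro hm
      rcases Nat.eq_zero_or_pos m with rfl | hm0
      · exact MulAction.mem_orbit_self _
      have hex : ∃ j : Fin (Fintype.card (Fin n)), j < ⟨m, hm⟩ ∧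
          (transGraph T).Adj (e ⟨m, hm⟩) (e j) := by
        by_cases hmk : m ≤ k
        · exact ⟨⟨0, hpos⟩, hm0, he1 _ _ hm0 hmk⟩
        · have := (he2 ⟨m, hm⟩ (by simp; omega)).1
          have h2 : 0 < {j : Fin (Fintype.card (Fin n)) | j < ⟨m, hm⟩ ∧
            (transGraph T).Adj (e ⟨m, hm⟩) (e j)}.ncard := by omega
          exact (Set.ncard_pos (Set.toFinite _)).1 h2
      obtain ⟨j, hj, hadj⟩ := hex
      have h1 := ih j.1 hj j.2
      have h2 : e ⟨m, hm⟩ ∈ MulAction.orbit (Subgroup.closure T) (e j) :=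
        (swap_mem_closure_isSwap hT).1 (Subgroup.subset_closure ((transGraph_adj _ _).1 hadj).2)
      rw [← MulAction.orbit_eq_iff] at h1 h2 ⊢
      exact h2.trans h1
  have horb' : ∀ x, x ∈ MulAction.orbit (Subgroup.closure T) (e ⟨0, hpos⟩) := by
    intro x
    obtain ⟨i, rfl⟩ := e.surjective x
    exact horb i.1 i.2
  rw [eq_top_iff, ← Equiv.Perm.closure_isSwap, Subgroup.closure_le]
  rintro t ⟨a, b, _, rfl⟩
  refine (swap_mem_closure_isSwap hT).2 ?_
  have h1 := horb' a
  have h2 := horb' b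
  rw [← MulAction.orbit_eq_iff] at h1 h2 ⊢
  exact h1.trans h2.symm

theorem sum_min (k : ℕ) : ∀ N : ℕ, k + 1 ≤ N →
    ∑ i ∈ range N, min i k = k * N - k * (k + 1) / 2 := by
  intro N hN
  induction N, hN using Nat.le_induction with
  | base =>
    have h1 : ∑ i ∈ range (k + 1), min i k = ∑ i ∈ range (k + 1), i :=
      Finset.sum_congr rfl (fun i hi => min_eq_left (by have := mem_range.1 hi; omega))
    rw [h1]
    have h2 := Finset.sum_range_id_mul_two (k + 1)
    rw [Nat.add_sub_cancel, mul_comm (k + 1) k] at h2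
    omega
  | succ N hN ih =>
    rw [Finset.sum_range_succ, ih, min_eq_right (by omega), mul_add k N 1]
    have : k * (k + 1) ≤ k * N := Nat.mul_le_mul_left k hN
    omega

theorem card_T {T : Set (Perm (Fin n))} (hT : ∀ t ∈ T, IsSwap t) (k : ℕ)
    (hkt : IsKTree k (transGraph T)) : T.toFinset.card = k * n - k * (k + 1) / 2 := by
  obtain ⟨hcard, e, he1, he2⟩ := hkt
  generalize hN : Fintype.card (Fin n) = N at *
  have hNn : N = n := by simpa using hN.symm
  let D : Fin N → Finset (Fin N) := fun i =>
    univ.filter (fun j => j < i ∧ (transGraph T).Adj (e i) (e j))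
  have hDc : ∀ i, (D i).card = min (i : ℕ) k := by
    intro i
    by_cases hik : (i : ℕ) ≤ k
    · rw [min_eq_left hik]
      have : D i = Finset.Iio i := by
        ext j
        simp only [D, mem_filter, mem_univ, true_and, mem_Iio]
        exact ⟨fun h => h.1, fun h => ⟨h, he1 i j h hik⟩⟩
      rw [this, Fin.card_Iio]
    · rw [min_eq_right (by omega), ← (he2 i (by omega)).1, Set.ncard_eq_toFinset_card']
      congr 1
      ext j
      simp [D]
  have hbij : (univ.sigma D).card = T.toFinset.card := by
    refine Finset.card_bij (fun p _ => swap (e p.1) (e p.2)) ?_ ?_ ?_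
    · rintro ⟨i, j⟩ h
      simp only [mem_sigma, mem_univ, true_and, D, mem_filter] at h
      simpa using ((transGraph_adj _ _).1 h.2).2
    · rintro ⟨i, j⟩ h ⟨i', j'⟩ h' heq
      simp only [mem_sigma, mem_univ, true_and, D, mem_filter] at h h'
      simp only at heq
      have hne : e i ≠ e j := fun h2 => h.1.ne' (e.injective h2)
      have a1 := congrArg (fun p : Perm (Fin n) => p (e i)) heq
      simp only [swap_apply_left] at a1
      by_cases c1 : i = i'
      · subst c1
        rw [swap_apply_left] at a1
        rw [e.injective a1]
      · by_cases c2 : i = j'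
        · subst c2
          rw [swap_apply_right] at a1
          have := e.injective a1
          subst this
          exact absurd (h.1.trans h'.1) (lt_irrefl _)
        · rw [swap_apply_of_ne_of_ne (fun h2 => c1 (e.injective h2))
            (fun h2 => c2 (e.injective h2))] at a1
          exact absurd a1.symm hne
    · intro t ht
      have ht : t ∈ T := by simpa using ht
      obtain ⟨a, b, hab, rfl⟩ := hT t ht
      obtain ⟨i, rfl⟩ := e.surjective a
      obtain ⟨j, rfl⟩ := e.surjective b
      have hij : i ≠ j := fun h => hab (by rw [h])
      rcases lt_or_gt_of_ne hij with hlt | hlt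
      · refine ⟨⟨j, i⟩, ?_, swap_comm _ _⟩
        simp only [mem_sigma, mem_univ, true_and, D, mem_filter]
        exact ⟨hlt, (transGraph_adj _ _).2 ⟨hab.symm, by rwa [swap_comm]⟩⟩
      · refine ⟨⟨i, j⟩, ?_, rfl⟩
        simp only [mem_sigma, mem_univ, true_and, D, mem_filter]
        exact ⟨hlt, (transGraph_adj _ _).2 ⟨hab, ht⟩⟩
  rw [← hbij, Finset.card_sigma, Finset.sum_congr rfl (fun i _ => hDc i),
    Fin.sum_univ_eq_sum_range (fun i => min i k) N, sum_min k N hcard, hNn]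

theorem num_bounds (k : ℕ) (hn : 5 ≤ n) (hk2 : 2 ≤ k) (hkn : k ≤ n - 1) :
    7 ≤ k * n - k * (k + 1) / 2 ∧ 2 * (k * n - k * (k + 1) / 2) < n.factorial := by
  obtain ⟨d, rfl⟩ : ∃ d, n = k + 1 + d := ⟨n - (k + 1), by omega⟩
  have hev : 2 * (k * (k + 1) / 2) = k * (k + 1) := Nat.mul_div_cancel' (Nat.even_mul_succ_self k).two_dvd
  have hexp : k * (k + 1 + d) = k * (k + 1) + k * d := by ring
  have h2m : 2 * (k * (k + 1 + d) - k * (k + 1) / 2) = k * (k + 1) + 2 * (k * d) := by omega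
  constructor
  · have : 14 ≤ k * (k + 1) + 2 * (k * d) := by
      rcases Nat.lt_or_ge k 4 with h | h
      · interval_cases k <;> omega
      · nlinarith [Nat.zero_le (k * d)]
    omega
  · rw [h2m]
    obtain ⟨q, hq⟩ : ∃ q, k + 1 + d = q + 2 := ⟨k + d - 1, by omega⟩
    have hq3 : 3 ≤ q := by omega
    have hf : (k + 1 + d).factorial = (q + 2) * ((q + 1) * q.factorial) := by
      rw [hq, Nat.factorial_succ, Nat.factorial_succ]
    have h6 : 6 ≤ q.factorial := by
      have := Nat.factorial_le hq3
      simpa [Nat.factorial] using this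
    have h1 : k * (k + 1) + 2 * (k * d) ≤ (q + 2) * (q + 1) := by
      have hq1 : q + 1 = k + d := by omega
      rw [← hq, hq1]
      nlinarith [Nat.zero_le (d * d)]
    rw [hf, ← mul_assoc (q + 2)]
    calc _ ≤ (q + 2) * (q + 1) := h1
      _ < (q + 2) * (q + 1) * 6 := by nlinarith [Nat.zero_le (q * q)]
      _ ≤ _ := Nat.mul_le_mul_left _ h6

end Cay

/-- For integers `n ≥ 5` and `2 ≤ k ≤ n-1`, the `R_1`-vertex-connectivity of the
Cayley graph `T_kG_n` generated by a `k`-tree on `n` vertices equals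
`2(kn - k(k+1)/2) - 2`. -/
theorem stmt1 (n k : ℕ) (hn : 5 ≤ n) (hk2 : 2 ≤ k) (hkn : k ≤ n - 1)
    (T : Set (Equiv.Perm (Fin n))) (hT : ∀ t ∈ T, Equiv.Perm.IsSwap t)
    (hkt : IsKTree k (transGraph T)) :
    rkConn (cayley T) 1 = 2 * (k * n - k * (k + 1) / 2) - 2 := by
  classical
  have hc := card_T hT k hkt
  obtain ⟨h7, hfac⟩ := num_bounds k hn hk2 hkn
  rw [← hc] at h7 hfac ⊢
  have htop := closure_top hT k (by omega) hkt
  unfold rkConn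
  refine (IsLeast.csInf_eq ⟨upper_cut hT h7 hfac, ?_⟩)
  rintro m ⟨F, hF, rfl⟩
  exact lower_cut hT h7 htop hfac F hF
end
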